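/- arXiv:1012.5493 — 2 statements merged into one kernel-verified Lean document; each statement's English description precedes it below -/
import Mathlib

section
/- Let α be irrational, let (q_n)_{n≥1} be positive integers with ‖q_nα‖ < 1/q_n and q_{n+1} > 10 q_n for all n, let φ(x) = Σ_{n=1}^∞ (2/n)(sin(2π q_n(x+α)) − sin(2π q_n x)), and let F = F_{α,φ} be the associated Anzai skew product on (ℝ/ℤ)×ℝ. Then for Haar-almost every x ∈ ℝ/ℤ and every y ∈ ℝ, the full orbit { Fⁿ(x,y) : n ∈ ℤ } is dense in (ℝ/ℤ)×ℝ; i.e. the set D = { x : 𝓛_x = ℝ } has full Haar measure in ℝ/ℤ. -/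
open Filter Topology MeasureTheory

noncomputable section

/-- The Anzai skew product `F(x,y) = (x+α, y+φ(x))` on `(ℝ/ℤ) × ℝ`, as a bijection. -/
def anzai (α : ℝ) (φ : AddCircle (1 : ℝ) → ℝ) : Equiv.Perm (AddCircle (1 : ℝ) × ℝ) where
  toFun z := (z.1 + (α : AddCircle (1 : ℝ)), z.2 + φ z.1)
  invFun z := (z.1 - (α : AddCircle (1 : ℝ)), z.2 - φ (z.1 - (α : AddCircle (1 : ℝ))))
  left_inv z := by simp
  right_inv z := by simp

/-- The limit set `λ(z)` of a point `z` under the Anzai skew product: all limits of sequences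
`F^{n_k}(z)` with `|n_k| → ∞` (the union of the α-limit and ω-limit sets). -/
def limitSet (α : ℝ) (φ : AddCircle (1 : ℝ) → ℝ) (z : AddCircle (1 : ℝ) × ℝ) :
    Set (AddCircle (1 : ℝ) × ℝ) :=
  {w | ∃ n : ℕ → ℤ, Tendsto (fun k => |n k|) atTop atTop ∧
    Tendsto (fun k => ((anzai α φ) ^ (n k)) z) atTop (𝓝 w)}

/-- Poincaré's set `𝓛_x = { y ∈ ℝ : (x,y) ∈ λ(x,0) }`. -/
def Lx (α : ℝ) (φ : AddCircle (1 : ℝ) → ℝ) (x : AddCircle (1 : ℝ)) : Set ℝ :=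
  {y | ((x, y) : AddCircle (1 : ℝ) × ℝ) ∈ limitSet α φ (x, 0)}

/-- `φ : ℝ/ℤ → ℝ` is absolutely continuous: there is `g ∈ L¹` with
`φ(x) − φ(0) = ∫₀ˣ g(t) dt` for all `x ∈ [0,1]`. -/
def AbsolutelyContinuous' (φ : AddCircle (1 : ℝ) → ℝ) : Prop :=
  ∃ g : ℝ → ℝ, IntegrableOn g (Set.Icc 0 1) ∧
    ∀ x ∈ Set.Icc (0 : ℝ) 1, φ (x : ℝ) - φ ((0 : ℝ) : AddCircle (1 : ℝ)) = ∫ t in (0 : ℝ)..x, g t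

/-- Conditions (3.1)–(3.4): `α` irrational, `φ` continuous with zero mean, the cohomological
equation `h ∘ R_α − h = φ` has no continuous solution, and `φ` is absolutely continuous. -/
def AnzaiConds (α : ℝ) (φ : AddCircle (1 : ℝ) → ℝ) : Prop :=
  Irrational α ∧ Continuous φ ∧ (∫ x : AddCircle (1 : ℝ), φ x = 0) ∧
  (¬ ∃ h : AddCircle (1 : ℝ) → ℝ, Continuous h ∧
      ∀ x, h (x + (α : AddCircle (1 : ℝ))) - h x = φ x) ∧
  AbsolutelyContinuous' φ

/-- The hypotheses on the sequence `(q_n)` (here indexed from `0`): each `q_n` is a positive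
integer with `‖q_n α‖ < 1/q_n` and `q_{n+1} > 10 q_n`, where `‖·‖` is the distance to the
nearest integer. -/
def QSeq (α : ℝ) (q : ℕ → ℕ) : Prop :=
  ∀ n : ℕ, 0 < q n ∧
    ‖(((q n : ℝ) * α : ℝ) : AddCircle (1 : ℝ))‖ < 1 / (q n : ℝ) ∧
    10 * q n < q (n + 1)

/-- The `n`-th term `(2/n)(sin(2π q_n(x+α)) − sin(2π q_n x))` of the series defining `φ`
(reindexed so that the index starts at `0`, with coefficient `2/(n+1)`). -/
def sinTerm (α : ℝ) (q : ℕ → ℕ) (n : ℕ) (x : ℝ) : ℝ :=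
  (2 / ((n : ℝ) + 1)) *
    (Real.sin (2 * Real.pi * (q n : ℝ) * (x + α)) - Real.sin (2 * Real.pi * (q n : ℝ) * x))

/-- The sum `φ(x) = Σₙ (2/n)(sin(2π q_n(x+α)) − sin(2π q_n x))` of the series, as a
(1-periodic) function on `ℝ`. -/
def phiSum (α : ℝ) (q : ℕ → ℕ) (x : ℝ) : ℝ := ∑' n : ℕ, sinTerm α q n x

/-- The partial sums `Σ_{k<N} (2/(k+1)) sin(2π q_k x)` of the transfer function. -/
def lacunarySum (q : ℕ → ℕ) (N : ℕ) (x : ℝ) : ℝ :=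
  ∑ k ∈ Finset.range N, (2 / ((k : ℝ) + 1)) * Real.sin (2 * Real.pi * (q k : ℝ) * x)

lemma continuous_lacunarySum (q : ℕ → ℕ) (N : ℕ) : Continuous (lacunarySum q N) := by
  unfold lacunarySum
  fun_prop

lemma lacunarySum_neg (q : ℕ → ℕ) (N : ℕ) (x : ℝ) :
    lacunarySum q N (-x) = -lacunarySum q N x := by
  simp [lacunarySum]

lemma periodic_lacunarySum (q : ℕ → ℕ) (N : ℕ) : Function.Periodic (lacunarySum q N) 1 := by
  intro x
  refine Finset.sum_congr rfl fun k _ => ?_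
  rw [← Real.sin_add_nat_mul_two_pi (2 * Real.pi * (q k : ℝ) * x) (q k)]
  congr 2
  ring

/-! ### Growth of the frequencies -/

lemma QSeq.pos {α : ℝ} {q : ℕ → ℕ} (hq : QSeq α q) (n : ℕ) : 0 < (q n : ℝ) := by
  exact_mod_cast (hq n).1

lemma QSeq.ten_mul_le {α : ℝ} {q : ℕ → ℕ} (hq : QSeq α q) (n : ℕ) :
    10 * (q n : ℝ) ≤ q (n + 1) := by
  exact_mod_cast (hq n).2.2.le

lemma QSeq.pow_mul_le {α : ℝ} {q : ℕ → ℕ} (hq : QSeq α q) (m j : ℕ) :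
    (10 : ℝ) ^ j * q m ≤ q (m + j) := by
  induction j with
  | zero => simp
  | succ j ih =>
    have := hq.ten_mul_le (m + j)
    rw [pow_succ, ← add_assoc]
    linarith

lemma QSeq.pow_le {α : ℝ} {q : ℕ → ℕ} (hq : QSeq α q) (n : ℕ) : (10 : ℝ) ^ n ≤ q n := by
  have h := hq.pow_mul_le 0 n
  have h0 : (1 : ℝ) ≤ q 0 := by exact_mod_cast (hq 0).1
  rw [zero_add] at h
  have : (0 : ℝ) < 10 ^ n := by positivity
  nlinarith

lemma QSeq.tendsto {α : ℝ} {q : ℕ → ℕ} (hq : QSeq α q) :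
    Tendsto (fun n => (q n : ℝ)) atTop atTop :=
  tendsto_atTop_mono hq.pow_le (tendsto_pow_atTop_atTop_of_one_lt (by norm_num))

lemma QSeq.ten_mul_le_of_lt {α : ℝ} {q : ℕ → ℕ} (hq : QSeq α q) {k l : ℕ} (h : k < l) :
    10 * (q k : ℝ) ≤ q l := by
  obtain ⟨j, rfl⟩ := Nat.exists_eq_add_of_lt h
  refine le_trans ?_ (hq.pow_mul_le k (j + 1))
  have : (1 : ℝ) ≤ 10 ^ j := one_le_pow₀ (by norm_num)
  have := hq.pos k
  rw [pow_succ]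
  nlinarith

lemma QSeq.sum_div_le {α : ℝ} {q : ℕ → ℕ} (hq : QSeq α q) (m : ℕ) :
    ∑ k ∈ Finset.range (m + 1), (q k : ℝ) / ((k : ℝ) + 1) ≤ 2 * q m / ((m : ℝ) + 1) := by
  induction m with
  | zero =>
    have := hq.pos 0
    simp
    linarith
  | succ m ih =>
    rw [Finset.sum_range_succ]
    have h10 := hq.ten_mul_le m
    have hp := hq.pos m
    have hp' := hq.pos (m + 1)
    have h2 : 2 * (q m : ℝ) / ((m : ℝ) + 1) ≤ (q (m + 1) : ℝ) / ((m : ℝ) + 1 + 1) := by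
      rw [div_le_div_iff₀ (by positivity) (by positivity)]
      nlinarith [mul_nonneg hp.le (Nat.cast_nonneg (α := ℝ) m),
        mul_le_mul_of_nonneg_right h10 (Nat.cast_nonneg (α := ℝ) m)]
    push_cast
    rw [mul_div_assoc]
    linarith

lemma QSeq.abs_lacunarySum_sub_le {α : ℝ} {q : ℕ → ℕ} (hq : QSeq α q) (m : ℕ) {x y : ℝ}
    (hxy : |x - y| ≤ 1 / q m) :
    |lacunarySum q (m + 1) x - lacunarySum q (m + 1) y| ≤ 8 * Real.pi / ((m : ℝ) + 1) := by
  have hm := hq.pos m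
  calc |lacunarySum q (m + 1) x - lacunarySum q (m + 1) y|
      ≤ ∑ k ∈ Finset.range (m + 1), 4 * Real.pi * |x - y| * ((q k : ℝ) / ((k : ℝ) + 1)) := by
        unfold lacunarySum
        rw [← Finset.sum_sub_distrib]
        refine (Finset.abs_sum_le_sum_abs _ _).trans (Finset.sum_le_sum fun k _ => ?_)
        rw [← mul_sub, abs_mul, abs_of_nonneg (by positivity : (0 : ℝ) ≤ 2 / ((k : ℝ) + 1))]
        have h := Real.abs_sin_sub_sin_le (2 * Real.pi * (q k : ℝ) * x)
          (2 * Real.pi * (q k : ℝ) * y)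
        rw [← mul_sub, abs_mul, abs_of_nonneg
          (by positivity : (0 : ℝ) ≤ 2 * Real.pi * (q k : ℝ))] at h
        refine (mul_le_mul_of_nonneg_left h (by positivity)).trans (le_of_eq ?_)
        ring
    _ = 4 * Real.pi * |x - y| * ∑ k ∈ Finset.range (m + 1), (q k : ℝ) / ((k : ℝ) + 1) := by
        rw [Finset.mul_sum]
    _ ≤ 4 * Real.pi * (1 / q m) * (2 * q m / ((m : ℝ) + 1)) := by
        gcongr
        exact hq.sum_div_le m
    _ = 8 * Real.pi / ((m : ℝ) + 1) := by
        field_simp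
        ring

/-! ### Local mean-square estimates -/

lemma abs_integral_cos_mul_le {c : ℝ} (hc : 0 < c) (a b : ℝ) :
    |∫ x in a..b, Real.cos (c * x)| ≤ 2 / c := by
  rw [intervalIntegral.integral_comp_mul_left _ hc.ne', integral_cos, smul_eq_mul, abs_mul,
    abs_of_pos (inv_pos.2 hc), div_eq_inv_mul]
  gcongr
  rw [abs_le]
  constructor <;>
  linarith [Real.sin_le_one (c * a), Real.sin_le_one (c * b), Real.neg_one_le_sin (c * a),
    Real.neg_one_le_sin (c * b)]

lemma abs_integral_sin_mul_sin_le {p r : ℝ} (hp : 0 < p) (hpr : 10 * p ≤ r) (a b : ℝ) :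
    |∫ x in a..b, Real.sin (2 * Real.pi * p * x) * Real.sin (2 * Real.pi * r * x)| ≤ 1 / r := by
  have hπ := Real.pi_gt_three
  have hr : 0 < r := by linarith
  have hA : 0 < 2 * Real.pi * (r - p) := by
    have : 0 < r - p := by linarith
    positivity
  have hB : 0 < 2 * Real.pi * (r + p) := by positivity
  have hpt : ∀ x : ℝ, Real.sin (2 * Real.pi * p * x) * Real.sin (2 * Real.pi * r * x) =
      (1 / 2) * (Real.cos (2 * Real.pi * (r - p) * x) - Real.cos (2 * Real.pi * (r + p) * x)) := by
    intro x
    rw [show 2 * Real.pi * (r - p) * x = 2 * Real.pi * r * x - 2 * Real.pi * p * x by ring,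
      show 2 * Real.pi * (r + p) * x = 2 * Real.pi * r * x + 2 * Real.pi * p * x by ring,
      Real.cos_sub, Real.cos_add]
    ring
  simp_rw [hpt]
  rw [intervalIntegral.integral_const_mul, intervalIntegral.integral_sub
    (Continuous.intervalIntegrable (by fun_prop) _ _)
    (Continuous.intervalIntegrable (by fun_prop) _ _), abs_mul, abs_of_pos (by norm_num)]
  have h1 := abs_integral_cos_mul_le hA a b
  have h2 := abs_integral_cos_mul_le hB a b
  have h3 := abs_sub (∫ x in a..b, Real.cos (2 * Real.pi * (r - p) * x))
    (∫ x in a..b, Real.cos (2 * Real.pi * (r + p) * x))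
  have h4 : 2 / (2 * Real.pi * (r - p)) ≤ 1 / r := by
    rw [div_le_div_iff₀ hA hr]
    nlinarith
  have h5 : 2 / (2 * Real.pi * (r + p)) ≤ 1 / r := by
    rw [div_le_div_iff₀ hB hr]
    nlinarith
  linarith

/-- On an interval of length at least `1 / q_m`, the block of frequencies beyond `q_m` has mean
square `O(1/m)`. -/
lemma QSeq.integral_sq_block_le {α : ℝ} {q : ℕ → ℕ} (hq : QSeq α q) (m j : ℕ) {a b : ℝ}
    (hab : 1 / (q m : ℝ) ≤ b - a) :
    ∫ x in a..b, (lacunarySum q (m + 1 + j) x - lacunarySum q (m + 1) x) ^ 2 ≤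
      (b - a) * (4 / ((m : ℝ) + 1) - 4 / ((m : ℝ) + 1 + j)
        + (1 - (1 / 10) ^ j) / ((m : ℝ) + 1)) := by
  have hm := hq.pos m
  have hℓ : 0 < b - a := lt_of_lt_of_le (by positivity) hab
  induction j with
  | zero => simp
  | succ j ih =>
    set L := m + 1 + j with hL
    set D : ℝ → ℝ := fun x => lacunarySum q L x - lacunarySum q (m + 1) x with hD
    have hDc : Continuous D := (continuous_lacunarySum q L).sub (continuous_lacunarySum q (m + 1))
    set s : ℝ → ℝ := fun x => Real.sin (2 * Real.pi * (q L : ℝ) * x) with hs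
    have hsc : Continuous s := by rw [hs]; fun_prop
    set c : ℝ := 2 / ((L : ℝ) + 1) with hc
    have hc0 : 0 < c := by positivity
    have hLpos := hq.pos L
    have hexp : ∀ x, (lacunarySum q (m + 1 + (j + 1)) x - lacunarySum q (m + 1) x) ^ 2 =
        D x ^ 2 + 2 * c * (D x * s x) + c ^ 2 * s x ^ 2 := by
      intro x
      have : lacunarySum q (m + 1 + (j + 1)) x = lacunarySum q L x + c * s x := by
        rw [← add_assoc]
        exact Finset.sum_range_succ _ _
      rw [this, hD]
      ring
    have hsplit : ∫ x in a..b, (lacunarySum q (m + 1 + (j + 1)) x - lacunarySum q (m + 1) x) ^ 2 =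
        (∫ x in a..b, D x ^ 2) + 2 * c * (∫ x in a..b, D x * s x)
          + c ^ 2 * ∫ x in a..b, s x ^ 2 := by
      simp_rw [hexp]
      rw [intervalIntegral.integral_add (Continuous.intervalIntegrable (by fun_prop) _ _)
        (Continuous.intervalIntegrable (by fun_prop) _ _), intervalIntegral.integral_add
        (Continuous.intervalIntegrable (by fun_prop) _ _)
        (Continuous.intervalIntegrable (by fun_prop) _ _), intervalIntegral.integral_const_mul,
        intervalIntegral.integral_const_mul]
    have hsq : ∫ x in a..b, s x ^ 2 ≤ b - a := by
      have h := intervalIntegral.integral_mono_on (μ := volume) (a := a) (b := b) (by linarith)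
        (Continuous.intervalIntegrable (by fun_prop : Continuous fun x => s x ^ 2) _ _)
        (Continuous.intervalIntegrable (continuous_const (y := (1 : ℝ))) _ _)
        (fun x _ => Real.sin_sq_le_one _)
      simpa using h
    have hcross : ∫ x in a..b, D x * s x ≤ j * (2 / ((m : ℝ) + 1) * (1 / q L)) := by
      have hDs : ∀ x, D x * s x = ∑ i ∈ Finset.range j,
          (2 / (((m + 1 + i : ℕ) : ℝ) + 1)) *
            (Real.sin (2 * Real.pi * (q (m + 1 + i) : ℝ) * x) *
              Real.sin (2 * Real.pi * (q L : ℝ) * x)) := by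
        intro x
        have : D x = ∑ i ∈ Finset.range j, (2 / (((m + 1 + i : ℕ) : ℝ) + 1)) *
            Real.sin (2 * Real.pi * (q (m + 1 + i) : ℝ) * x) := by
          simp only [hD, lacunarySum, hL, Finset.sum_range_add]
          ring
        rw [this, Finset.sum_mul]
        simp only [hs, mul_assoc]
      simp_rw [hDs]
      rw [intervalIntegral.integral_finsetSum
        (fun i _ => Continuous.intervalIntegrable (by fun_prop) _ _)]
      have hle : ∀ i ∈ Finset.range j, (∫ x in a..b, (2 / (((m + 1 + i : ℕ) : ℝ) + 1)) *
            (Real.sin (2 * Real.pi * (q (m + 1 + i) : ℝ) * x) *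
              Real.sin (2 * Real.pi * (q L : ℝ) * x))) ≤ 2 / ((m : ℝ) + 1) * (1 / q L) := by
        intro i hi
        rw [intervalIntegral.integral_const_mul]
        have hlt : m + 1 + i < L := by
          have := Finset.mem_range.1 hi
          omega
        have h := abs_integral_sin_mul_sin_le (hq.pos (m + 1 + i)) (hq.ten_mul_le_of_lt hlt) a b
        have h' := (le_abs_self _).trans h
        refine (mul_le_mul_of_nonneg_left h' (by positivity)).trans ?_
        gcongr
        omega
      simpa using Finset.sum_le_card_nsmul _ _ _ hle
    have hqL : 1 / (q L : ℝ) ≤ (1 / 10) ^ (j + 1) * (b - a) := by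
      have h := hq.pow_mul_le m (j + 1)
      rw [show m + (j + 1) = L by omega] at h
      calc 1 / (q L : ℝ) ≤ 1 / (10 ^ (j + 1) * q m) := by gcongr
        _ = (1 / 10) ^ (j + 1) * (1 / q m) := by
          rw [one_div_pow, one_div_mul_one_div]
        _ ≤ _ := by gcongr
    have hLr : (L : ℝ) = (m : ℝ) + 1 + j := by rw [hL]; push_cast; ring
    have hcj : c * j ≤ 2 := by
      rw [hc, div_mul_eq_mul_div, div_le_iff₀ (by positivity), hLr]
      nlinarith [Nat.cast_nonneg (α := ℝ) m]
    have hcrossfinal : 2 * c * (∫ x in a..b, D x * s x) ≤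
        (b - a) * ((9 * (1 / 10) ^ (j + 1)) / ((m : ℝ) + 1)) := by
      calc 2 * c * (∫ x in a..b, D x * s x)
          ≤ 2 * c * (j * (2 / ((m : ℝ) + 1) * (1 / q L))) := by gcongr
        _ = (c * j) * (4 / ((m : ℝ) + 1) * (1 / q L)) := by ring
        _ ≤ 2 * (4 / ((m : ℝ) + 1) * ((1 / 10) ^ (j + 1) * (b - a))) := by gcongr
        _ = (b - a) * ((8 * (1 / 10) ^ (j + 1)) / ((m : ℝ) + 1)) := by ring
        _ ≤ _ := by
          gcongr
          norm_num
    have hsqfinal : c ^ 2 * (∫ x in a..b, s x ^ 2) ≤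
        (b - a) * (4 / ((m : ℝ) + 1 + j) - 4 / ((m : ℝ) + 1 + (j + 1 : ℕ))) := by
      calc c ^ 2 * (∫ x in a..b, s x ^ 2) ≤ c ^ 2 * (b - a) := by gcongr
        _ = (b - a) * c ^ 2 := mul_comm _ _
        _ ≤ _ := by
          gcongr
          rw [hc, hLr, div_sub_div _ _ (by positivity) (by positivity), div_pow,
            div_le_div_iff₀ (by positivity) (by positivity)]
          push_cast
          have h1 : (0 : ℝ) ≤ (m : ℝ) + 1 + j := by positivity
          rw [← add_assoc]
          generalize (m : ℝ) + 1 + j = t at h1 ⊢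
          nlinarith [mul_nonneg h1 h1]
    rw [hsplit]
    refine (add_le_add (add_le_add ih hcrossfinal) hsqfinal).trans (le_of_eq ?_)
    rw [pow_succ]
    ring

lemma QSeq.integral_sq_sub_le {α : ℝ} {q : ℕ → ℕ} (hq : QSeq α q) {m N : ℕ} (hN : m + 1 ≤ N)
    {a b : ℝ} (hab : 1 / (q m : ℝ) ≤ b - a) :
    ∫ x in a..b, (lacunarySum q N x - lacunarySum q (m + 1) x) ^ 2 ≤
      (b - a) * (5 / ((m : ℝ) + 1)) := by
  obtain ⟨j, rfl⟩ := Nat.exists_eq_add_of_le hN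
  have hm := hq.pos m
  have hℓ : 0 < b - a := lt_of_lt_of_le (by positivity) hab
  refine (hq.integral_sq_block_le m j hab).trans (mul_le_mul_of_nonneg_left ?_ hℓ.le)
  have h1 : (0 : ℝ) ≤ 4 / ((m : ℝ) + 1 + j) := by positivity
  have h2 : (1 - (1 / 10 : ℝ) ^ j) / ((m : ℝ) + 1) ≤ 1 / ((m : ℝ) + 1) := by
    gcongr
    have : (0 : ℝ) ≤ (1 / 10) ^ j := by positivity
    linarith
  have h3 : (5 : ℝ) / ((m : ℝ) + 1) = 4 / ((m : ℝ) + 1) + 1 / ((m : ℝ) + 1) := by ring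
  linarith

lemma QSeq.lintegral_sq_sub_le {α : ℝ} {q : ℕ → ℕ} (hq : QSeq α q) {m N : ℕ} (hN : m + 1 ≤ N)
    {a b : ℝ} (hab : 1 / (q m : ℝ) ≤ b - a) :
    ∫⁻ x in Set.Ioc a b, ENNReal.ofReal ((lacunarySum q N x - lacunarySum q (m + 1) x) ^ 2) ≤
      ENNReal.ofReal ((b - a) * (5 / ((m : ℝ) + 1))) := by
  have hm := hq.pos m
  have hℓ : 0 < b - a := lt_of_lt_of_le (by positivity) hab
  have hc : Continuous fun x => (lacunarySum q N x - lacunarySum q (m + 1) x) ^ 2 :=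
    ((continuous_lacunarySum q N).sub (continuous_lacunarySum q (m + 1))).pow 2
  rw [← ofReal_integral_eq_lintegral_ofReal (hc.integrableOn_Ioc)
    (Eventually.of_forall fun x => sq_nonneg _),
    ← intervalIntegral.integral_of_le (by linarith)]
  exact ENNReal.ofReal_le_ofReal (hq.integral_sq_sub_le hN hab)

/-! ### Partial sums take every value on every interval -/

lemma half_le_sin_of_mem {u : ℝ} (h1 : Real.pi / 6 ≤ u) (h2 : u ≤ 5 * Real.pi / 6) :
    1 / 2 ≤ Real.sin u := by
  rcases le_total u (Real.pi / 2) with h | h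
  · rw [← Real.sin_pi_div_six]
    exact Real.sin_le_sin_of_le_of_le_pi_div_two (by linarith [Real.pi_pos]) h h1
  · rw [← Real.sin_pi_div_six, ← Real.sin_pi_sub u]
    exact Real.sin_le_sin_of_le_of_le_pi_div_two (by linarith [Real.pi_pos]) (by linarith)
      (by linarith)

lemma exists_Icc_half_le_sin {p : ℝ} (hp : 0 < p) (a : ℝ) :
    ∃ c, a ≤ c ∧ c + 1 / (3 * p) ≤ a + 2 / p ∧
      ∀ x ∈ Set.Icc c (c + 1 / (3 * p)), 1 / 2 ≤ Real.sin (2 * Real.pi * p * x) := by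
  have h1 := Int.le_ceil (p * a)
  have h2 := Int.ceil_lt_add_one (p * a)
  set k : ℤ := ⌈p * a⌉
  refine ⟨(k + 1 / 12) / p, ?_, ?_, fun x hx => ?_⟩
  · rw [le_div_iff₀ hp]
    linarith
  · have : ((k : ℝ) + 1 / 12) / p + 1 / (3 * p) = (k + 5 / 12) / p := by
      field_simp
      ring
    rw [this, div_le_iff₀ hp, add_mul, div_mul_cancel₀ _ hp.ne']
    linarith
  · obtain ⟨hx1, hx2⟩ := hx
    have hx2' : x ≤ (k + 5 / 12) / p := by
      refine hx2.trans (le_of_eq ?_)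
      field_simp
      ring
    rw [div_le_iff₀ hp] at hx1
    rw [le_div_iff₀ hp] at hx2'
    rw [← Real.sin_sub_int_mul_two_pi _ k]
    have hπ := Real.pi_pos
    apply half_le_sin_of_mem <;> nlinarith

lemma QSeq.exists_forall_half_le_sin {α : ℝ} {q : ℕ → ℕ} (hq : QSeq α q) {a b : ℝ} {N : ℕ}
    (hN : 2 / (q N : ℝ) ≤ b - a) (M : ℕ) :
    ∃ x ∈ Set.Icc a b, ∀ n, N ≤ n → n ≤ N + M → 1 / 2 ≤ Real.sin (2 * Real.pi * (q n : ℝ) * x) := by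
  suffices h : ∃ c, a ≤ c ∧ c + 1 / (3 * (q (N + M) : ℝ)) ≤ b ∧
      ∀ x ∈ Set.Icc c (c + 1 / (3 * (q (N + M) : ℝ))), ∀ n, N ≤ n → n ≤ N + M →
        1 / 2 ≤ Real.sin (2 * Real.pi * (q n : ℝ) * x) by
    obtain ⟨c, h1, h2, h3⟩ := h
    have : (0 : ℝ) ≤ 1 / (3 * (q (N + M) : ℝ)) := by positivity
    exact ⟨c, ⟨h1, by linarith⟩, h3 c ⟨le_rfl, by linarith⟩⟩
  induction M with
  | zero =>
    obtain ⟨c, h1, h2, h3⟩ := exists_Icc_half_le_sin (hq.pos N) a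
    refine ⟨c, h1, by simpa using h2.trans (by linarith), fun x hx n hn hn' => ?_⟩
    obtain rfl : n = N := by omega
    exact h3 x hx
  | succ M ih =>
    obtain ⟨c, h1, h2, h3⟩ := ih
    obtain ⟨d, g1, g2, g3⟩ := exists_Icc_half_le_sin (hq.pos (N + M + 1)) c
    have hp := hq.pos (N + M)
    have hle : 2 / (q (N + M + 1) : ℝ) ≤ 1 / (3 * (q (N + M) : ℝ)) := by
      rw [div_le_div_iff₀ (hq.pos _) (by positivity)]
      linarith [hq.ten_mul_le (N + M)]
    refine ⟨d, h1.trans g1, by rw [← add_assoc]; linarith, fun x hx n hn hn' => ?_⟩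
    rw [← add_assoc] at hx
    rcases Nat.lt_or_ge (N + M) n with h | h
    · obtain rfl : n = N + M + 1 := by omega
      exact g3 x hx
    · exact h3 x ⟨g1.trans hx.1, hx.2.trans (by linarith)⟩ n hn h

lemma QSeq.eventually_exists_lt_lacunarySum {α : ℝ} {q : ℕ → ℕ} (hq : QSeq α q) {a b : ℝ}
    (hab : a < b) (B : ℝ) :
    ∀ᶠ M in atTop, ∃ x ∈ Set.Icc a b, B < lacunarySum q M x := by
  obtain ⟨N, hN⟩ : ∃ N, 2 / (q N : ℝ) ≤ b - a :=
    ((hq.tendsto.const_div_atTop 2).eventually_le_const (sub_pos.2 hab)).exists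
  set C : ℝ := ∑ k ∈ Finset.range N, 2 / ((k : ℝ) + 1) with hC
  have hlim : Tendsto (fun M : ℕ => ∑ k ∈ Finset.range M, 1 / ((k : ℝ) + 1)) atTop atTop :=
    Real.tendsto_sum_range_one_div_nat_succ_atTop
  filter_upwards [hlim.eventually_gt_atTop (B + 2 * C), eventually_ge_atTop N] with M hM hNM
  obtain ⟨j, rfl⟩ := Nat.exists_eq_add_of_le hNM
  obtain ⟨x, hx, hsin⟩ := hq.exists_forall_half_le_sin hN j
  refine ⟨x, hx, ?_⟩
  have hhead : ∑ k ∈ Finset.range N, 1 / ((k : ℝ) + 1) - 2 * C ≤ lacunarySum q N x := by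
    rw [hC, Finset.mul_sum, ← Finset.sum_sub_distrib]
    refine Finset.sum_le_sum fun k _ => ?_
    have hk : (0 : ℝ) < 1 / ((k : ℝ) + 1) := by positivity
    have h2 : (2 : ℝ) / ((k : ℝ) + 1) = 2 * (1 / ((k : ℝ) + 1)) := by ring
    rw [h2]
    nlinarith [Real.neg_one_le_sin (2 * Real.pi * (q k : ℝ) * x)]
  have htail : ∑ i ∈ Finset.range j, 1 / (((N + i : ℕ) : ℝ) + 1) ≤
      ∑ i ∈ Finset.range j, (2 / (((N + i : ℕ) : ℝ) + 1)) *
        Real.sin (2 * Real.pi * (q (N + i) : ℝ) * x) := by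
    refine Finset.sum_le_sum fun i hi => ?_
    have hi' := Finset.mem_range.1 hi
    have hk : (0 : ℝ) < 1 / (((N + i : ℕ) : ℝ) + 1) := by positivity
    have h2 : (2 : ℝ) / (((N + i : ℕ) : ℝ) + 1) = 2 * (1 / (((N + i : ℕ) : ℝ) + 1)) := by ring
    rw [h2]
    nlinarith [hsin (N + i) (by omega) (by omega)]
  rw [Finset.sum_range_add] at hM
  rw [lacunarySum, Finset.sum_range_add]
  rw [lacunarySum] at hhead
  linarith

lemma QSeq.eventually_exists_lacunarySum_eq {α : ℝ} {q : ℕ → ℕ} (hq : QSeq α q) {a b : ℝ}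
    (hab : a < b) (v : ℝ) :
    ∀ᶠ M in atTop, ∃ x ∈ Set.Icc a b, lacunarySum q M x = v := by
  filter_upwards [hq.eventually_exists_lt_lacunarySum hab v,
    hq.eventually_exists_lt_lacunarySum (neg_lt_neg hab) (-v)] with M h1 h2
  obtain ⟨x, hx, hxv⟩ := h1
  obtain ⟨y, hy, hyv⟩ := h2
  rw [← neg_neg y, lacunarySum_neg, neg_lt_neg_iff] at hyv
  exact isPreconnected_Icc.intermediate_value (a := -y)
    ⟨by linarith [hy.2], by linarith [hy.1]⟩ hx (continuous_lacunarySum q M).continuousOn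
    ⟨hyv.le, hxv.le⟩

/-! ### The cocycle is the coboundary of the lacunary series -/

lemma QSeq.abs_sinTerm_le {α : ℝ} {q : ℕ → ℕ} (hq : QSeq α q) (n : ℕ) (x : ℝ) :
    |sinTerm α q n x| ≤ 4 * Real.pi * (1 / 10) ^ n := by
  have hn := hq.pos n
  set r : ℤ := round ((q n : ℝ) * α)
  have hr : |(q n : ℝ) * α - r| ≤ (1 / 10) ^ n := by
    have h := (hq n).2.1.le
    rw [UnitAddCircle.norm_eq] at h
    refine h.trans ?_
    rw [one_div_pow]
    exact one_div_le_one_div_of_le (by positivity) (hq.pow_le n)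
  have hsin : |Real.sin (2 * Real.pi * (q n : ℝ) * (x + α)) -
      Real.sin (2 * Real.pi * (q n : ℝ) * x)| ≤ 2 * Real.pi * (1 / 10) ^ n := by
    rw [← Real.sin_sub_int_mul_two_pi (2 * Real.pi * (q n : ℝ) * (x + α)) r]
    refine (Real.abs_sin_sub_sin_le _ _).trans ?_
    rw [show 2 * Real.pi * (q n : ℝ) * (x + α) - r * (2 * Real.pi) - 2 * Real.pi * (q n : ℝ) * x
      = 2 * Real.pi * ((q n : ℝ) * α - r) by ring, abs_mul,
      abs_of_pos (by positivity : (0 : ℝ) < 2 * Real.pi)]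
    gcongr
  have hcoef : (2 : ℝ) / ((n : ℝ) + 1) ≤ 2 := by
    rw [div_le_iff₀ (by positivity)]
    nlinarith [Nat.cast_nonneg (α := ℝ) n]
  rw [sinTerm, abs_mul, abs_of_nonneg (by positivity : (0 : ℝ) ≤ 2 / ((n : ℝ) + 1))]
  calc _ ≤ 2 * (2 * Real.pi * (1 / 10) ^ n) := by gcongr
    _ = _ := by ring

lemma QSeq.tendsto_lacunarySum_sub {α : ℝ} {q : ℕ → ℕ} (hq : QSeq α q) (x : ℝ) :
    Tendsto (fun N => lacunarySum q N (x + α) - lacunarySum q N x) atTop (𝓝 (phiSum α q x)) := by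
  have hsum : Summable fun n => sinTerm α q n x :=
    Summable.of_norm_bounded
      ((summable_geometric_of_lt_one (by norm_num) (by norm_num : (1 / 10 : ℝ) < 1)).mul_left
        (4 * Real.pi)) (fun n => hq.abs_sinTerm_le n x)
  refine hsum.hasSum.tendsto_sum_nat.congr fun N => ?_
  simp only [lacunarySum, sinTerm, mul_sub, Finset.sum_sub_distrib]

/-- The partial sums of the transfer function, as functions on the circle. -/
def circleSum (q : ℕ → ℕ) (N : ℕ) : AddCircle (1 : ℝ) → ℝ :=
  (periodic_lacunarySum q N).lift

lemma circleSum_coe (q : ℕ → ℕ) (N : ℕ) (x : ℝ) :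
    circleSum q N (x : AddCircle (1 : ℝ)) = lacunarySum q N x := rfl

lemma continuous_circleSum (q : ℕ → ℕ) (N : ℕ) : Continuous (circleSum q N) :=
  continuous_coinduced_dom.2 (continuous_lacunarySum q N)

lemma QSeq.eLpNorm_circleSum_sub_le {α : ℝ} {q : ℕ → ℕ} (hq : QSeq α q) {m N : ℕ}
    (hN : m + 1 ≤ N) :
    eLpNorm (circleSum q N - circleSum q (m + 1)) 2 volume ≤
      ENNReal.ofReal (5 / ((m : ℝ) + 1)) ^ (1 / 2 : ℝ) := by
  have hm : (1 : ℝ) ≤ q m := by exact_mod_cast (hq m).1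
  rw [eLpNorm_eq_lintegral_rpow_enorm_toReal (by norm_num) (by norm_num)]
  simp only [ENNReal.toReal_ofNat]
  gcongr
  rw [← UnitAddCircle.lintegral_preimage 0]
  have h := hq.lintegral_sq_sub_le hN (a := 0) (b := 0 + 1) (by
    rw [zero_add, sub_zero, div_le_one (by linarith)]
    exact hm)
  simp only [zero_add, sub_zero, one_mul] at h ⊢
  refine le_trans (le_of_eq ?_) h
  refine lintegral_congr fun x => ?_
  rw [Pi.sub_apply, circleSum_coe, circleSum_coe, Real.enorm_eq_ofReal_abs,
    ENNReal.ofReal_rpow_of_nonneg (abs_nonneg _) (by norm_num)]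
  norm_num

lemma QSeq.ae_exists_tendsto {α : ℝ} {q : ℕ → ℕ} (hq : QSeq α q) :
    ∀ᵐ x : AddCircle (1 : ℝ), ∃ l, Tendsto (fun j => circleSum q (16 ^ j) x) atTop (𝓝 l) := by
  have hbound : ∀ J n, J ≤ n → eLpNorm (circleSum q (16 ^ n) - circleSum q (16 ^ J)) 2 volume ≤
      ENNReal.ofReal (3 * (1 / 4) ^ J) := by
    intro J n hJn
    obtain ⟨m, hm⟩ : ∃ m, 16 ^ J = m + 1 := Nat.exists_eq_succ_of_ne_zero (by positivity)
    have hle : m + 1 ≤ 16 ^ n := hm ▸ Nat.pow_le_pow_right (by norm_num) hJn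
    rw [hm]
    refine (hq.eLpNorm_circleSum_sub_le hle).trans ?_
    rw [ENNReal.ofReal_rpow_of_nonneg (by positivity) (by norm_num)]
    refine ENNReal.ofReal_le_ofReal ?_
    rw [← Real.sqrt_eq_rpow]
    refine Real.sqrt_le_iff.2 ⟨by positivity, ?_⟩
    have hm' : (m : ℝ) + 1 = 16 ^ J := by exact_mod_cast hm.symm
    rw [hm', mul_pow, ← pow_mul, mul_comm J 2, pow_mul, div_eq_mul_inv, ← inv_pow]
    norm_num
  refine Lp.ae_tendsto_of_cauchy_eLpNorm (p := 2)
    (B := fun J => ENNReal.ofReal (7 * (1 / 4) ^ J))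
    (fun n => (continuous_circleSum q _).aestronglyMeasurable) (by norm_num) ?_ ?_
  · have hs : Summable fun J : ℕ => (7 : ℝ) * (1 / 4) ^ J :=
      (summable_geometric_of_lt_one (by norm_num) (by norm_num)).mul_left 7
    exact hs.tsum_ofReal_ne_top
  · intro J n m hn hm
    have h1 := hbound J n hn
    have h2 := hbound J m hm
    have hmeas : ∀ k, AEStronglyMeasurable (circleSum q (16 ^ k) - circleSum q (16 ^ J))
        (volume : Measure (AddCircle (1 : ℝ))) := fun k =>
      ((continuous_circleSum q _).sub (continuous_circleSum q _)).aestronglyMeasurable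
    calc eLpNorm (circleSum q (16 ^ n) - circleSum q (16 ^ m)) 2 volume
        = eLpNorm ((circleSum q (16 ^ n) - circleSum q (16 ^ J)) -
            (circleSum q (16 ^ m) - circleSum q (16 ^ J))) 2 volume := by
          congr 1
          abel
      _ ≤ _ := eLpNorm_sub_le (hmeas n) (hmeas m) (by norm_num)
      _ ≤ ENNReal.ofReal (3 * (1 / 4) ^ J) + ENNReal.ofReal (3 * (1 / 4) ^ J) :=
          add_le_add h1 h2
      _ < ENNReal.ofReal (7 * (1 / 4) ^ J) := by
          rw [← ENNReal.ofReal_add (by positivity) (by positivity)]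
          have : (0 : ℝ) < (1 / 4) ^ J := by positivity
          exact (ENNReal.ofReal_lt_ofReal_iff (by positivity)).2 (by linarith)

/-- A measurable transfer function: an almost everywhere limit of partial sums. -/
def transfer (q : ℕ → ℕ) (x : AddCircle (1 : ℝ)) : ℝ :=
  limUnder atTop fun j => circleSum q (16 ^ j) x

lemma QSeq.ae_tendsto_transfer {α : ℝ} {q : ℕ → ℕ} (hq : QSeq α q) :
    ∀ᵐ x : AddCircle (1 : ℝ),
      Tendsto (fun j => circleSum q (16 ^ j) x) atTop (𝓝 (transfer q x)) := by
  filter_upwards [hq.ae_exists_tendsto] with x hx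
  exact tendsto_nhds_limUnder hx

lemma QSeq.aemeasurable_transfer {α : ℝ} {q : ℕ → ℕ} (hq : QSeq α q) :
    AEMeasurable (transfer q) :=
  aemeasurable_of_tendsto_metrizable_ae _
    (fun j => (continuous_circleSum q (16 ^ j)).measurable.aemeasurable) hq.ae_tendsto_transfer

lemma QSeq.eq_transfer_sub {α : ℝ} {q : ℕ → ℕ} (hq : QSeq α q)
    {φ : AddCircle (1 : ℝ) → ℝ} (hφ : ∀ x : ℝ, φ (x : ℝ) = phiSum α q x) {x : AddCircle (1 : ℝ)}
    (hx : Tendsto (fun j => circleSum q (16 ^ j) x) atTop (𝓝 (transfer q x)))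
    (hx' : Tendsto (fun j => circleSum q (16 ^ j) (x + (α : AddCircle (1 : ℝ)))) atTop
      (𝓝 (transfer q (x + (α : AddCircle (1 : ℝ)))))) :
    φ x = transfer q (x + (α : AddCircle (1 : ℝ))) - transfer q x := by
  induction x using QuotientAddGroup.induction_on with
  | H t =>
    refine tendsto_nhds_unique ?_ (hx'.sub hx)
    have h := (hq.tendsto_lacunarySum_sub t).comp
      (tendsto_pow_atTop_atTop_of_one_lt (by norm_num : 1 < 16))
    rw [← hφ t] at h
    exact h

/-! ### The graph of the transfer function is essentially dense -/

lemma QSeq.volume_transfer_pos {α : ℝ} {q : ℕ → ℕ} (hq : QSeq α q) {U : Set (AddCircle (1 : ℝ))}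
    (hU : IsOpen U) (hUne : U.Nonempty) {V : Set ℝ} (hV : IsOpen V) (hVne : V.Nonempty) :
    volume (U ∩ transfer q ⁻¹' V) ≠ 0 := by
  intro hzero
  obtain ⟨x₀, hx₀⟩ := hUne
  obtain ⟨v, hv⟩ := hVne
  obtain ⟨ε, hε, hball⟩ : ∃ ε > 0, ∀ w, |w - v| < 2 * ε → w ∈ V := by
    obtain ⟨δ, hδ, h⟩ := Metric.isOpen_iff.1 hV v hv
    refine ⟨δ / 2, by positivity, fun w hw => h ?_⟩
    rw [Metric.mem_ball, Real.dist_eq]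
    linarith
  obtain ⟨t, rfl⟩ := QuotientAddGroup.mk_surjective x₀
  obtain ⟨η, hη, hηU⟩ : ∃ η > 0, ∀ s : ℝ, |s - t| < 2 * η → (s : AddCircle (1 : ℝ)) ∈ U := by
    have hpre : IsOpen ((fun s : ℝ => (s : AddCircle (1 : ℝ))) ⁻¹' U) :=
      hU.preimage (AddCircle.continuous_mk' 1)
    obtain ⟨δ, hδ, h⟩ := Metric.isOpen_iff.1 hpre t hx₀
    refine ⟨δ / 2, by positivity, fun w hw => h ?_⟩
    rw [Metric.mem_ball, Real.dist_eq]
    linarith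
  have hinv : Tendsto (fun m : ℕ => 1 / ((m : ℝ) + 1)) atTop (𝓝 0) :=
    tendsto_one_div_add_atTop_nhds_zero_nat
  have hvar : ∀ᶠ m : ℕ in atTop, 8 * Real.pi * (1 / ((m : ℝ) + 1)) < ε := by
    have := hinv.const_mul (8 * Real.pi)
    rw [mul_zero] at this
    exact this.eventually_lt_const hε
  have hmean : ∀ᶠ m : ℕ in atTop, 5 * (1 / ((m : ℝ) + 1)) < ε ^ 2 := by
    have := hinv.const_mul 5
    rw [mul_zero] at this
    exact this.eventually_lt_const (by positivity)
  have hval := (tendsto_add_atTop_nat 1).eventually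
    (hq.eventually_exists_lacunarySum_eq (show t < t + η / 2 by linarith) v)
  have hlen : ∀ᶠ m : ℕ in atTop, 1 / (q m : ℝ) < η :=
    (hq.tendsto.const_div_atTop 1).eventually_lt_const hη
  obtain ⟨m, hvar, hmean, ⟨c, hc, hcv⟩, hlen⟩ :=
    (hvar.and (hmean.and (hval.and hlen))).exists
  have hm1 : (1 : ℝ) ≤ q m := by exact_mod_cast (hq m).1
  have hm : (0 : ℝ) < q m := by linarith
  set ℓ : ℝ := 1 / (q m : ℝ) with hℓ
  have hℓ0 : 0 < ℓ := by positivity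
  have hℓ1 : ℓ ≤ 1 := by
    rw [hℓ, div_le_one hm]
    exact hm1
  have hae : ∀ᵐ s : ℝ ∂volume.restrict (Set.Ioc c (c + ℓ)),
      ε ^ 2 ≤ (transfer q (s : AddCircle (1 : ℝ)) - lacunarySum q (m + 1) s) ^ 2 ∧
      Tendsto (fun j => lacunarySum q (16 ^ j) s) atTop
        (𝓝 (transfer q (s : AddCircle (1 : ℝ)))) := by
    have hnull : ∀ᵐ x : AddCircle (1 : ℝ), x ∉ U ∩ transfer q ⁻¹' V :=
      measure_eq_zero_iff_ae_notMem.1 hzero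
    have hup := (UnitAddCircle.measurePreserving_mk c).quasiMeasurePreserving.ae
      (hnull.and hq.ae_tendsto_transfer)
    have hup' := ae_restrict_of_ae_restrict_of_subset
      (Set.Ioc_subset_Ioc_right (by linarith : c + ℓ ≤ c + 1)) hup
    filter_upwards [hup', ae_restrict_mem measurableSet_Ioc] with s hs hsJ
    refine ⟨?_, hs.2⟩
    have hsU : (s : AddCircle (1 : ℝ)) ∈ U := by
      refine hηU s ?_
      rw [abs_lt]
      constructor <;> linarith [hc.1, hc.2, hsJ.1, hsJ.2]
    have hfar : 2 * ε ≤ |transfer q (s : AddCircle (1 : ℝ)) - v| := by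
      by_contra hlt
      exact hs.1 ⟨hsU, hball _ (not_le.1 hlt)⟩
    have hclose := hq.abs_lacunarySum_sub_le m (x := s) (y := c) (by
      rw [abs_le]
      constructor <;> linarith [hsJ.1, hsJ.2])
    rw [hcv] at hclose
    have hclose' : |lacunarySum q (m + 1) s - v| < ε := by
      refine hclose.trans_lt (lt_of_eq_of_lt ?_ hvar)
      ring
    have htri := abs_sub_le (transfer q (s : AddCircle (1 : ℝ))) (lacunarySum q (m + 1) s) v
    rw [← sq_abs (_ - _)]
    exact pow_le_pow_left₀ hε.le (by linarith) 2
  have hfatou : ENNReal.ofReal (ε ^ 2) * ENNReal.ofReal ℓ ≤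
      ENNReal.ofReal (ℓ * (5 / ((m : ℝ) + 1))) := by
    calc ENNReal.ofReal (ε ^ 2) * ENNReal.ofReal ℓ
        = ∫⁻ _ in Set.Ioc c (c + ℓ), ENNReal.ofReal (ε ^ 2) := by simp
      _ ≤ ∫⁻ s in Set.Ioc c (c + ℓ), liminf (fun j => ENNReal.ofReal
            ((lacunarySum q (16 ^ j) s - lacunarySum q (m + 1) s) ^ 2)) atTop := by
          refine lintegral_mono_ae ?_
          filter_upwards [hae] with s hs
          have hlim := (ENNReal.continuous_ofReal.tendsto _).comp
            ((hs.2.sub_const (lacunarySum q (m + 1) s)).pow 2)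
          refine (ENNReal.ofReal_le_ofReal hs.1).trans (le_of_eq ?_)
          exact hlim.liminf_eq.symm
      _ ≤ liminf (fun j => ∫⁻ s in Set.Ioc c (c + ℓ), ENNReal.ofReal
            ((lacunarySum q (16 ^ j) s - lacunarySum q (m + 1) s) ^ 2)) atTop :=
          lintegral_liminf_le fun j => (((continuous_lacunarySum q _).sub
            (continuous_lacunarySum q _)).pow 2).measurable.ennreal_ofReal
      _ ≤ ENNReal.ofReal (ℓ * (5 / ((m : ℝ) + 1))) := by
          refine liminf_le_of_frequently_le' (Eventually.frequently ?_)
          filter_upwards [(tendsto_pow_atTop_atTop_of_one_lt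
            (by norm_num : 1 < 16)).eventually_ge_atTop (m + 1)] with j hj
          have h := hq.lintegral_sq_sub_le hj (a := c) (b := c + ℓ) (by simp [hℓ])
          rwa [add_sub_cancel_left] at h
  rw [← ENNReal.ofReal_mul (by positivity), ENNReal.ofReal_le_ofReal_iff (by positivity)] at hfatou
  have h5 : (5 : ℝ) / ((m : ℝ) + 1) = 5 * (1 / ((m : ℝ) + 1)) := by ring
  rw [h5] at hfatou
  nlinarith

/-! ### Dynamics -/

lemma ergodic_rotation {α : ℝ} (hα : Irrational α) :
    Ergodic (fun x : AddCircle (1 : ℝ) => x + (α : AddCircle (1 : ℝ))) := by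
  rwa [AddCircle.ergodic_add_right, ← AddCircle.denseRange_zsmul_iff,
    AddCircle.denseRange_zsmul_coe_iff, div_one]

/-- Almost every forward orbit of an ergodic map visits a given set of positive measure. -/
lemma Ergodic.ae_exists_iterate_mem {X : Type*} [MeasurableSpace X] {μ : Measure X}
    [IsFiniteMeasure μ] {T : X → X} (hT : Ergodic T μ) {E : Set X} (hE : NullMeasurableSet E μ)
    (hpos : μ E ≠ 0) : ∀ᵐ x ∂μ, ∃ n : ℕ, T^[n] x ∈ E := by
  set W : Set X := ⋃ n : ℕ, T^[n] ⁻¹' E with hW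
  have hWm : NullMeasurableSet W μ := .iUnion fun n =>
    hE.preimage (hT.toMeasurePreserving.iterate n).quasiMeasurePreserving
  have hsub : T ⁻¹' W ⊆ W := by
    intro x hx
    obtain ⟨n, hn⟩ := Set.mem_iUnion.1 hx
    exact Set.mem_iUnion.2 ⟨n + 1, hn⟩
  rcases hT.ae_empty_or_univ_of_preimage_ae_le hWm hsub.eventuallyLE with h | h
  · exact absurd (measure_mono_null (Set.subset_iUnion (fun n : ℕ => T^[n] ⁻¹' E) 0)
      (ae_eq_empty.1 h)) hpos
  · filter_upwards [eventuallyEq_univ.1 h] with x hx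
    exact Set.mem_iUnion.1 hx

lemma iterate_rotation (α : ℝ) (n : ℕ) (x : AddCircle (1 : ℝ)) :
    (fun x : AddCircle (1 : ℝ) => x + (α : AddCircle (1 : ℝ)))^[n] x
      = x + n • (α : AddCircle (1 : ℝ)) := by
  simp [add_right_iterate]

/-- If `φ` is the coboundary of `h` along the forward orbit of `x`, the orbits of the skew product
follow the translated graph of `h`. -/
lemma anzai_pow_apply {α : ℝ} {φ h : AddCircle (1 : ℝ) → ℝ} {x : AddCircle (1 : ℝ)}
    (hx : ∀ n : ℕ, φ (x + n • (α : AddCircle (1 : ℝ))) =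
      h (x + n • (α : AddCircle (1 : ℝ)) + (α : AddCircle (1 : ℝ))) -
        h (x + n • (α : AddCircle (1 : ℝ)))) (y : ℝ) (n : ℕ) :
    ((anzai α φ) ^ n) (x, y) =
      (x + n • (α : AddCircle (1 : ℝ)), y - h x + h (x + n • (α : AddCircle (1 : ℝ)))) := by
  induction n with
  | zero => simp
  | succ n ih =>
    rw [pow_succ', Equiv.Perm.mul_apply, ih]
    simp only [anzai, Equiv.coe_fn_mk, hx n, succ_nsmul, add_assoc, Prod.mk.injEq, true_and]
    ring

/-- A dense orbit approaches every point along times tending to infinity in absolute value. -/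
lemma mem_limitSet_of_dense {α : ℝ} {φ : AddCircle (1 : ℝ) → ℝ} {z : AddCircle (1 : ℝ) × ℝ}
    (hd : Dense (Set.range fun n : ℤ => ((anzai α φ) ^ n) z)) (w : AddCircle (1 : ℝ) × ℝ) :
    w ∈ limitSet α φ z := by
  have hex : ∀ k : ℕ, ∃ n : ℤ, (k : ℤ) ≤ |n| ∧
      dist (((anzai α φ) ^ n) z) w < 1 / ((k : ℝ) + 1) := by
    intro k
    have hfin : ((fun n : ℤ => ((anzai α φ) ^ n) z) '' Set.Icc (-(k : ℤ)) k).Finite :=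
      (Set.finite_Icc _ _).image _
    obtain ⟨p, hp, hdist⟩ := (hd.sdiff_finite hfin).exists_dist_lt w
      (by positivity : (0 : ℝ) < 1 / ((k : ℝ) + 1))
    obtain ⟨⟨n, rfl⟩, hn⟩ := hp
    refine ⟨n, ?_, by rwa [dist_comm]⟩
    by_contra hlt
    exact hn ⟨n, abs_le.1 (not_le.1 hlt).le, rfl⟩
  choose n hn hdist using hex
  refine ⟨n, tendsto_atTop_mono hn tendsto_natCast_atTop_atTop, ?_⟩
  exact tendsto_iff_dist_tendsto_zero.2 (squeeze_zero (fun _ => dist_nonneg)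
    (fun k => (hdist k).le) tendsto_one_div_add_atTop_nhds_zero_nat)

/-- For Haar-almost every `x` and every `y`, the full orbit of `(x,y)` under the Anzai skew
product `F_{α,φ}` is dense in `(ℝ/ℤ) × ℝ`; i.e. the set `D = {x : 𝓛_x = ℝ}` has full Haar
measure. -/
theorem stmt_17 (α : ℝ) (hα : Irrational α) (q : ℕ → ℕ) (hq : QSeq α q)
    (φ : AddCircle (1 : ℝ) → ℝ) (hφ : ∀ x : ℝ, φ (x : ℝ) = phiSum α q x) :
    ∀ᵐ x : AddCircle (1 : ℝ),
      (∀ y : ℝ, Dense (Set.range fun n : ℤ => ((anzai α φ) ^ n) (x, y))) ∧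
      Lx α φ x = Set.univ := by
  have herg := ergodic_rotation hα
  have hgood : ∀ᵐ x : AddCircle (1 : ℝ), ∀ n : ℕ, Tendsto
      (fun j => circleSum q (16 ^ j) (x + n • (α : AddCircle (1 : ℝ)))) atTop
        (𝓝 (transfer q (x + n • (α : AddCircle (1 : ℝ))))) := by
    rw [ae_all_iff]
    intro n
    exact (measurePreserving_add_right volume _).quasiMeasurePreserving.ae hq.ae_tendsto_transfer
  have hvisit : ∀ᵐ x : AddCircle (1 : ℝ),
      ∀ U ∈ TopologicalSpace.countableBasis (AddCircle (1 : ℝ)),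
      ∀ V ∈ TopologicalSpace.countableBasis ℝ, ∃ n : ℕ,
        x + n • (α : AddCircle (1 : ℝ)) ∈ U ∩ transfer q ⁻¹' V := by
    rw [ae_ball_iff (TopologicalSpace.countable_countableBasis _)]
    intro U hU
    rw [ae_ball_iff (TopologicalSpace.countable_countableBasis _)]
    intro V hV
    have hUo := TopologicalSpace.isOpen_of_mem_countableBasis hU
    have hVo := TopologicalSpace.isOpen_of_mem_countableBasis hV
    have hpos := hq.volume_transfer_pos hUo (TopologicalSpace.nonempty_of_mem_countableBasis hU)
      hVo (TopologicalSpace.nonempty_of_mem_countableBasis hV)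
    have hmeas : NullMeasurableSet (U ∩ transfer q ⁻¹' V) :=
      hUo.measurableSet.nullMeasurableSet.inter
        (hq.aemeasurable_transfer.nullMeasurableSet_preimage hVo.measurableSet)
    filter_upwards [herg.ae_exists_iterate_mem hmeas hpos] with x hx
    obtain ⟨n, hn⟩ := hx
    rw [iterate_rotation] at hn
    exact ⟨n, hn⟩
  filter_upwards [hgood, hvisit] with x hx hxv
  have hcob : ∀ n : ℕ, φ (x + n • (α : AddCircle (1 : ℝ))) =
      transfer q (x + n • (α : AddCircle (1 : ℝ)) + (α : AddCircle (1 : ℝ))) -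
        transfer q (x + n • (α : AddCircle (1 : ℝ))) := by
    intro n
    refine hq.eq_transfer_sub hφ (hx n) ?_
    have h := hx (n + 1)
    rwa [succ_nsmul, ← add_assoc] at h
  have hdense : ∀ y : ℝ, Dense (Set.range fun n : ℤ => ((anzai α φ) ^ n) (x, y)) := by
    intro y
    rw [dense_iff_inter_open]
    rintro O hO ⟨⟨u, w⟩, huw⟩
    set c : ℝ := y - transfer q x with hc
    have hO' : IsOpen ((fun p : AddCircle (1 : ℝ) × ℝ => (p.1, c + p.2)) ⁻¹' O) :=
      hO.preimage (by fun_prop)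
    obtain ⟨S, T, hS, hT, huS, hwT, hST⟩ := isOpen_prod_iff.1 hO' u (w - c) (by simpa using huw)
    obtain ⟨U, hU, huU, hUS⟩ :=
      (TopologicalSpace.isBasis_countableBasis _).exists_subset_of_mem_open huS hS
    obtain ⟨V, hV, hwV, hVT⟩ :=
      (TopologicalSpace.isBasis_countableBasis _).exists_subset_of_mem_open hwT hT
    obtain ⟨n, hn⟩ := hxv U hU V hV
    refine ⟨((anzai α φ) ^ (n : ℤ)) (x, y), ?_, ⟨n, rfl⟩⟩
    rw [zpow_natCast, anzai_pow_apply hcob]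
    exact hST (Set.mk_mem_prod (hUS hn.1) (hVT hn.2))
  exact ⟨hdense, Set.eq_univ_of_forall fun y => mem_limitSet_of_dense (hdense 0) (x, y)⟩
end
end

section
/- Let F = F_{α,φ} be an Anzai skew product with α irrational, ∫_{ℝ/ℤ} φ(x) dx = 0, and φ absolutely continuous. Let (x₀,y₀) ∈ (ℝ/ℤ)×ℝ and suppose there are real numbers 0 < a < b and ε > 0 such that the full orbit { Fⁿ(x₀,y₀) : n ∈ ℤ } is disjoint from the set { (x,y) : ‖x−x₀‖ ≤ ε and a ≤ |y−y₀| ≤ b }. Then there exists δ > 0 such that the orbit is disjoint from { (x,y) : ‖x−x₀‖ ≤ δ and |y−y₀| ≥ a }; in particular the orbit { Fⁿ(x₀,y₀) : n ∈ ℤ } is a bounded subset of (ℝ/ℤ)×ℝ (its second coordinates form a bounded set of reals). -/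
open Filter Topology MeasureTheory

noncomputable section

/-- `m / q` is a reduced fraction approximating `α` with error less than `1 / q ^ 2`. -/
structure IsGoodApprox (α : ℝ) (q : ℕ) (m : ℤ) : Prop where
  pos : 0 < q
  coprime : IsCoprime m (q : ℤ)
  error_lt : |q * α - m| < 1 / q

/-- A best approximation of the second kind is a good approximation. -/
theorem isGoodApprox_of_best {α : ℝ} (hα : Irrational α) {q : ℕ} {m : ℤ} (hq : 0 < q)
    (hbest : ∀ n : ℕ, 0 < n → n ≤ q → ∀ k : ℤ, |q * α - m| ≤ |n * α - k|) :
    IsGoodApprox α q m := by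
  refine ⟨hq, ?_, ?_⟩
  · rw [Int.isCoprime_iff_gcd_eq_one]
    by_contra hd
    obtain ⟨m', hm'⟩ : (Int.gcd m q : ℤ) ∣ m := Int.gcd_dvd_left ..
    obtain ⟨q', hq'⟩ : Int.gcd m q ∣ q := by exact_mod_cast Int.gcd_dvd_right (a := m) (b := (q : ℤ))
    set d := Int.gcd m q with hd_def
    have hd0 : 0 < d := Nat.pos_of_ne_zero (by rintro h; simp [h] at hq'; omega)
    have hd2 : 2 ≤ d := by omega
    have hq'_pos : 0 < q' := Nat.pos_of_ne_zero (by rintro h; simp [h] at hq'; omega)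
    have h := hbest q' hq'_pos (by rw [hq']; exact Nat.le_mul_of_pos_left q' hd0) m'
    have e : (q : ℝ) * α - m = d * (q' * α - m') := by
      rw [hm']; nth_rewrite 1 [hq']; push_cast; ring
    have hne : 0 < |(q' : ℝ) * α - m'| := by
      rw [abs_pos, sub_ne_zero]
      exact_mod_cast (hα.natCast_mul hq'_pos.ne').ne_int m'
    rw [e, abs_mul, Nat.abs_cast] at h
    have : (2 : ℝ) ≤ d := by exact_mod_cast hd2
    nlinarith
  · obtain ⟨j, k, hk, hkq, hjk⟩ := Real.exists_int_int_abs_mul_sub_le α hq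
    lift k to ℕ using hk.le
    refine (hbest k (by exact_mod_cast hk) (by exact_mod_cast hkq) j).trans_lt ?_
    refine lt_of_le_of_lt (by exact_mod_cast hjk) ?_
    have : (0 : ℝ) < q := by exact_mod_cast hq
    push_cast
    exact one_div_lt_one_div_of_lt this (by linarith)

/-- Two consecutive best approximations of an irrational number, approximating it from opposite
sides, with arbitrarily small error and arbitrarily large second denominator. -/
theorem exists_consecutive_goodApprox {α : ℝ} (hα : Irrational α) {δ : ℝ} (hδ : 0 < δ) (N : ℕ) :
    ∃ (p q : ℕ) (m l : ℤ), IsGoodApprox α p m ∧ IsGoodApprox α q l ∧ p ≤ q ∧ N < q ∧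
      |p * α - m| < δ ∧ |q * α - l| < |p * α - m| ∧ (p * α - m) * (q * α - l) < 0 ∧
      ∀ n : ℕ, 0 < n → n < q → ∀ k : ℤ, |p * α - m| ≤ |n * α - k| := by
  obtain ⟨N₁, hN₁⟩ := exists_nat_one_div_lt hδ
  set M := max N N₁ + 1 with hM
  set f : ℕ → ℝ := fun n => |n * α - round (n * α)| with hf
  have hfle : ∀ n : ℕ, ∀ k : ℤ, f n ≤ |n * α - k| := fun n k => round_le _ _
  have hfpos : ∀ n : ℕ, 0 < n → 0 < f n := fun n hn => by
    rw [hf, abs_pos, sub_ne_zero]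
    exact_mod_cast (hα.natCast_mul hn.ne').ne_int _
  have hdir : ∀ n : ℕ, 0 < n → ∃ k : ℕ, 0 < k ∧ k ≤ n ∧ f k ≤ 1 / (n + 1) := fun n hn => by
    obtain ⟨j, k, hk, hkq, hjk⟩ := Real.exists_int_int_abs_mul_sub_le α hn
    lift k to ℕ using hk.le
    exact ⟨k, by exact_mod_cast hk, by exact_mod_cast hkq, (hfle k j).trans (by exact_mod_cast hjk)⟩
  obtain ⟨p, hp, hpmin⟩ := Finset.exists_min_image (Finset.Icc 1 M) f ⟨1, by simp [hM]⟩
  rw [Finset.mem_Icc] at hp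
  have hpmin' : ∀ n, 0 < n → n ≤ M → f p ≤ f n := fun n h1 h2 =>
    hpmin n (Finset.mem_Icc.2 ⟨h1, h2⟩)
  have hex : ∃ n, 0 < n ∧ f n < f p := by
    obtain ⟨n, hn⟩ := exists_nat_one_div_lt (hfpos p hp.1)
    obtain ⟨k, hk, -, hkn⟩ := hdir (n + 1) n.succ_pos
    refine ⟨k, hk, hkn.trans_lt (lt_of_le_of_lt ?_ hn)⟩
    exact one_div_le_one_div_of_le (by positivity) (by push_cast; linarith)
  classical
  set q := Nat.find hex with hq
  obtain ⟨hq0, hqp⟩ : 0 < q ∧ f q < f p := Nat.find_spec hex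
  have hqmin : ∀ n, 0 < n → n < q → f p ≤ f n := fun n h1 h2 => by
    by_contra! h
    exact Nat.find_min hex h2 ⟨h1, h⟩
  have hMq : M < q := by
    by_contra! h
    exact absurd (hpmin' q hq0 h) hqp.not_ge
  refine ⟨p, q, round (p * α), round (q * α), ?_, ?_, by omega, by omega, ?_, hqp, ?_, ?_⟩
  · exact isGoodApprox_of_best hα hp.1 fun n h1 h2 k => (hpmin' n h1 (by omega)).trans (hfle n k)
  · refine isGoodApprox_of_best hα hq0 fun n h1 h2 k => ?_
    refine le_trans ?_ (hfle n k)
    rcases h2.eq_or_lt with rfl | h2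
    · exact le_rfl
    · exact hqp.le.trans (hqmin n h1 h2)
  · obtain ⟨k, hk, hkM, hkf⟩ := hdir M (by omega)
    refine ((hpmin' k hk hkM).trans hkf).trans_lt (lt_of_le_of_lt ?_ hN₁)
    refine one_div_le_one_div_of_le (by positivity) ?_
    have : (N₁ : ℝ) ≤ M := by exact_mod_cast (by omega)
    linarith
  · by_contra! h
    have hlt : q - p < q := by omega
    have h1 := (hqmin (q - p) (by omega) hlt).trans (hfle _ (round (q * α) - round (p * α)))
    have h2 := hfpos q hq0
    rw [Nat.cast_sub (by omega)] at h1
    push_cast at h1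
    simp only [hf] at h1 h2 hqp
    set u := (p : ℝ) * α - round (p * α)
    set v := (q : ℝ) * α - round (q * α)
    have e : ((q : ℝ) - p) * α - (round (q * α) - round (p * α)) = v - u := by
      simp only [u, v]; ring
    rw [e] at h1
    rcases abs_cases u with hu | hu <;> rcases abs_cases v with hv | hv <;>
      rcases abs_cases (v - u) with hw | hw <;> nlinarith
  · exact fun n h1 h2 k => (hqmin n h1 h2).trans (hfle n k)

/-- Every integer `n` whose multiple `n * α` lies in `[-γ, β)` modulo one, with `β`, `-γ` the
errors of two consecutive best approximations with denominators `p`, `q`, is reached from `0` by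
steps `±p`, `±q` staying in `[-γ, β)` modulo one. -/
theorem induction_on_returns {α : ℝ} {p q : ℕ} {m l : ℤ} (hp : 0 < p) (hpq : p ≤ q)
    (hγ : 0 < l - q * α) (hlt : l - q * α < p * α - m)
    (hbest : ∀ n : ℕ, 0 < n → n < q → ∀ k : ℤ, p * α - m ≤ |n * α - k|)
    {P : ℤ → Prop} (h0 : P 0)
    (hstep : ∀ n n' : ℤ, |n - n'| = p ∨ |n - n'| = q →
      (∃ k : ℤ, |n' * α - k| ≤ p * α - m) → P n → P n')
    (n k : ℤ) (hl : -(l - q * α) ≤ n * α - k) (hr : n * α - k < p * α - m) : P n := by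
  have hq : (0 : ℤ) < q := by omega
  have habs : |n * α - k| ≤ p * α - m := abs_le.2 ⟨by linarith, by linarith⟩
  have habs' : |n * α - k| < p * α - m := abs_lt.2 ⟨by linarith, by linarith⟩
  induction hN : n.natAbs using Nat.strong_induction_on generalizing n k with
  | _ N ih =>
  subst hN
  rcases lt_trichotomy n 0 with hn | rfl | hn
  · have hnq : n ≤ -q := by
      by_contra! h
      have := hbest n.natAbs (by omega) (by omega) (-k)
      have e : ((n.natAbs : ℕ) : ℝ) = -n := by
        rw [Nat.cast_natAbs, abs_of_neg hn]; push_cast; ring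
      rw [e, ← abs_neg] at this
      push_cast at this
      have e2 : -(-(n : ℝ) * α - -k) = n * α - k := by ring
      rw [e2] at this
      linarith
    rcases lt_or_ge (n * α - k) 0 with ht | ht
    · refine hstep (n + p) n (Or.inl (by simp)) ⟨k, habs⟩ ?_
      have e : ((n + p : ℤ) : ℝ) * α - (k + m : ℤ) = n * α - k + (p * α - m) := by push_cast; ring
      refine ih _ (by omega) (n + p) (k + m) ?_ ?_ ?_ ?_ rfl <;> rw [e]
      · linarith
      · linarith
      · exact abs_le.2 ⟨by linarith, by linarith⟩
      · exact abs_lt.2 ⟨by linarith, by linarith⟩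
    · refine hstep (n + q) n (Or.inr (by simp)) ⟨k, habs⟩ ?_
      have e : ((n + q : ℤ) : ℝ) * α - (k + l : ℤ) = n * α - k - (l - q * α) := by push_cast; ring
      refine ih _ (by omega) (n + q) (k + l) ?_ ?_ ?_ ?_ rfl <;> rw [e]
      · linarith
      · linarith
      · exact abs_le.2 ⟨by linarith, by linarith⟩
      · exact abs_lt.2 ⟨by linarith, by linarith⟩
  · exact h0
  · have hnq : q ≤ n := by
      by_contra! h
      have := hbest n.natAbs (by omega) (by omega) k
      have e : ((n.natAbs : ℕ) : ℝ) = n := by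
        rw [Nat.cast_natAbs, abs_of_pos hn]
      rw [e] at this
      linarith
    rcases le_or_gt (p * α - m - (l - q * α)) (n * α - k) with ht | ht
    · refine hstep (n - p) n (Or.inl (by simp)) ⟨k, habs⟩ ?_
      have e : ((n - p : ℤ) : ℝ) * α - (k - m : ℤ) = n * α - k - (p * α - m) := by push_cast; ring
      refine ih _ (by omega) (n - p) (k - m) ?_ ?_ ?_ ?_ rfl <;> rw [e]
      · linarith
      · linarith
      · exact abs_le.2 ⟨by linarith, by linarith⟩
      · exact abs_lt.2 ⟨by linarith, by linarith⟩
    · refine hstep (n - q) n (Or.inr (by simp)) ⟨k, habs⟩ ?_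
      have e : ((n - q : ℤ) : ℝ) * α - (k - l : ℤ) = n * α - k + (l - q * α) := by push_cast; ring
      refine ih _ (by omega) (n - q) (k - l) ?_ ?_ ?_ ?_ rfl <;> rw [e]
      · linarith
      · linarith
      · exact abs_le.2 ⟨by linarith, by linarith⟩
      · exact abs_lt.2 ⟨by linarith, by linarith⟩

/-- The symmetric form of `induction_on_returns`, whatever the sides of the approximations. -/
theorem induction_on_returns_abs {α : ℝ} {p q : ℕ} {m l : ℤ} (hp : 0 < p) (hpq : p ≤ q)
    (hlt : |q * α - l| < |p * α - m|) (hneg : (p * α - m) * (q * α - l) < 0)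
    (hbest : ∀ n : ℕ, 0 < n → n < q → ∀ k : ℤ, |p * α - m| ≤ |n * α - k|)
    {P : ℤ → Prop} (h0 : P 0)
    (hstep : ∀ n n' : ℤ, |n - n'| = p ∨ |n - n'| = q →
      (∃ k : ℤ, |n' * α - k| ≤ |p * α - m|) → P n → P n')
    (n k : ℤ) (h : |n * α - k| ≤ |q * α - l|) : P n := by
  rcases mul_neg_iff.1 hneg with ⟨h1, h2⟩ | ⟨h1, h2⟩
  · rw [abs_of_neg h2] at h hlt
    simp only [abs_of_pos h1] at hbest hlt hstep
    exact induction_on_returns hp hpq (by linarith) (by linarith) hbest h0 hstep n k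
      (by linarith [abs_le.1 h]) (by linarith [abs_le.1 h])
  · rw [abs_of_pos h2] at h hlt
    simp only [abs_of_neg h1] at hbest hlt hstep
    have e : ∀ (x : ℝ) (k : ℤ), |x * -α - k| = |x * α - (-k : ℤ)| := fun x k => by
      rw [← abs_neg]; congr 1; push_cast; ring
    refine induction_on_returns (α := -α) (m := -m) (l := -l) hp hpq (by push_cast; linarith)
      (by push_cast; linarith) (fun n hn hnq k => ?_) h0
      (fun n n' hnn hk => hstep n n' hnn ?_) n (-k)
      (by push_cast; linarith [abs_le.1 h]) (by push_cast; linarith [abs_le.1 h])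
    · rw [e]
      have := hbest n hn hnq (-k)
      push_cast at this ⊢
      linarith
    · obtain ⟨k, hk⟩ := hk
      refine ⟨-k, ?_⟩
      rw [e] at hk
      push_cast at hk ⊢
      linarith

/-- The sum of `{y + j α} - 1/2` over `j < q` is bounded when `q` is the denominator of a good
approximation of `α`. -/
theorem IsGoodApprox.abs_sum_fract_le {α : ℝ} {q : ℕ} {m : ℤ} (h : IsGoodApprox α q m) (y : ℝ) :
    |∑ j ∈ Finset.range q, (Int.fract (y + j * α) - 1 / 2)| ≤ 5 := by
  have hq := h.pos
  have hq' : (0 : ℝ) < q := by exact_mod_cast hq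
  set r : ℕ → ℕ := fun j => ((⌊q * y⌋ + j * m) % q).toNat with hr
  have hrc : ∀ j, ((r j : ℕ) : ℤ) = (⌊q * y⌋ + j * m) % q := fun j =>
    Int.toNat_of_nonneg (Int.emod_nonneg _ (by omega))
  have hrlt : ∀ j, r j < q := fun j => by
    have := Int.emod_lt_of_pos (⌊q * y⌋ + j * m) (b := (q : ℤ)) (by omega)
    rw [← hrc] at this
    exact_mod_cast this
  have hinj : Set.InjOn r (Finset.range q) := by
    intro i hi j hj hij
    simp only [Finset.coe_range, Set.mem_Iio] at hi hj
    have h1 : (⌊q * y⌋ + i * m) % q = (⌊q * y⌋ + j * m) % q := by rw [← hrc, ← hrc, hij]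
    have h2 : (q : ℤ) ∣ (j - i) * m := by
      have := Int.ModEq.dvd h1
      rwa [show ⌊q * y⌋ + j * m - (⌊q * y⌋ + i * m) = (j - i) * m by ring] at this
    have h3 : (q : ℤ) ∣ j - i := h.coprime.symm.dvd_of_dvd_mul_right h2
    have h4 := Int.eq_zero_of_abs_lt_dvd h3 (by rw [abs_lt]; omega)
    omega
  have himg : (Finset.range q).image r = Finset.range q :=
    Finset.eq_of_subset_of_card_le
      (Finset.image_subset_iff.2 fun j _ => Finset.mem_range.2 (hrlt j))
      (by rw [Finset.card_image_of_injOn hinj])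
  have hperm : ∀ f : ℕ → ℝ, ∑ j ∈ Finset.range q, f (r j) = ∑ j ∈ Finset.range q, f j := fun f => by
    conv_rhs => rw [← himg, Finset.sum_image hinj]
  have hpt : ∀ j ∈ Finset.range q, |Int.fract (y + j * α) - r j / q| ≤
      2 / q + (if r j = 0 then 1 else 0) + (if r j = q - 1 then 1 else 0) := by
    intro j hj
    have hjq : (j : ℝ) + 1 ≤ q := by exact_mod_cast Finset.mem_range.1 hj
    have hrq : (r j : ℝ) + 1 ≤ q := by exact_mod_cast hrlt j
    have hr0 : (0 : ℝ) ≤ r j / q := by positivity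
    have hr1 : (r j : ℝ) / q < 1 := by rw [div_lt_one hq']; linarith
    have h2q : 0 < 2 / (q : ℝ) := by positivity
    have hf0 := Int.fract_nonneg (y + j * α)
    have hf1 := Int.fract_lt_one (y + j * α)
    have hle1 : |Int.fract (y + j * α) - r j / q| ≤ 1 := abs_le.2 ⟨by linarith, by linarith⟩
    by_cases h0 : r j = 0
    · rw [if_pos h0]
      split_ifs <;> linarith
    by_cases h1 : r j = q - 1
    · rw [if_pos h1, if_neg h0]
      linarith
    rw [if_neg h0, if_neg h1, add_zero, add_zero]
    have hr1' : (1 : ℝ) ≤ r j := by exact_mod_cast Nat.one_le_iff_ne_zero.2 h0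
    have hr2' : (r j : ℝ) + 2 ≤ q := by
      have := hrlt j
      exact_mod_cast (by omega : r j + 2 ≤ q)
    obtain ⟨w, hw⟩ : ∃ w : ℤ, ⌊q * y⌋ + j * m = r j + q * w :=
      ⟨(⌊q * y⌋ + j * m) / q, by rw [hrc]; exact (Int.emod_add_mul_ediv ..).symm⟩
    have hw' : (⌊q * y⌋ : ℝ) + j * m = r j + q * w := by exact_mod_cast hw
    have hfl := Int.floor_le (q * y)
    have hfl' := Int.lt_floor_add_one (q * y)
    have hθ : |j * (q * α - m)| < 1 := by
      have hd := h.error_lt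
      rw [lt_div_iff₀ hq'] at hd
      rw [abs_mul, Nat.abs_cast]
      have := abs_nonneg (q * α - m)
      nlinarith
    rw [abs_lt] at hθ
    have hu : q * (y + j * α - w) = r j + (q * y - ⌊q * y⌋) + j * (q * α - m) := by
      linear_combination hw'
    have hfr : Int.fract (y + j * α) = y + j * α - w := by
      rw [Int.fract_eq_iff]
      refine ⟨?_, ?_, w, by ring⟩
      · by_contra! hc
        nlinarith
      · by_contra! hc
        nlinarith
    rw [hfr, abs_le]
    have e : y + j * α - w - r j / q = ((q * y - ⌊q * y⌋) + j * (q * α - m)) / q := by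
      rw [eq_div_iff hq'.ne', sub_mul, div_mul_cancel₀ _ hq'.ne']
      linarith
    rw [e, neg_div', div_le_div_iff_of_pos_right hq', div_le_div_iff_of_pos_right hq']
    constructor <;> linarith
  have hsum : ∑ j ∈ Finset.range q, ((r j : ℝ) / q - 1 / 2) = -(1 / 2) := by
    rw [hperm (fun i => (i : ℝ) / q - 1 / 2), Finset.sum_sub_distrib, ← Finset.sum_div]
    have := Finset.sum_range_id_mul_two q
    have h2 : (∑ i ∈ Finset.range q, (i : ℝ)) * 2 = q * (q - 1) := by
      rw [← Nat.cast_pred hq, ← Nat.cast_sum]; exact_mod_cast this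
    rw [eq_div_of_mul_eq two_ne_zero h2]
    simp
    field_simp
    ring
  have hbd : ∑ j ∈ Finset.range q, |Int.fract (y + j * α) - r j / q| ≤ 4 := by
    refine (Finset.sum_le_sum hpt).trans ?_
    rw [hperm (fun i => 2 / (q : ℝ) + (if i = 0 then 1 else 0) + (if i = q - 1 then 1 else 0)),
      Finset.sum_add_distrib, Finset.sum_add_distrib, Finset.sum_ite_eq', Finset.sum_ite_eq']
    simp [hq, mul_div_cancel₀ _ hq'.ne']
    norm_num
  have e : ∑ j ∈ Finset.range q, (Int.fract (y + j * α) - 1 / 2) =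
      ∑ j ∈ Finset.range q, (Int.fract (y + j * α) - r j / q) - 1 / 2 := by
    rw [sub_eq_add_neg _ (1 / 2 : ℝ), ← hsum, ← Finset.sum_add_distrib]
    exact Finset.sum_congr rfl fun _ _ => by ring
  rw [e]
  have := (Finset.abs_sum_le_sum_abs (fun j : ℕ => Int.fract (y + j * α) - r j / q)
    (Finset.range q)).trans hbd
  rw [abs_le] at this ⊢
  constructor <;> linarith

/-- The sawtooth function `x ↦ {x} - 1/2` on the circle. -/
def sawtooth (x : AddCircle (1 : ℝ)) : ℝ := (AddCircle.measurableEquivIco 1 0 x : ℝ) - 1 / 2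

theorem sawtooth_coe (x : ℝ) : sawtooth (x : AddCircle (1 : ℝ)) = Int.fract x - 1 / 2 := by
  change (AddCircle.equivIco 1 0 (x : AddCircle (1 : ℝ)) : ℝ) - 1 / 2 = _
  rw [AddCircle.coe_equivIco_mk_apply, div_one, mul_one]

theorem measurable_sawtooth : Measurable sawtooth :=
  (measurable_subtype_coe.comp (AddCircle.measurableEquivIco 1 0).measurable).sub_const _

theorem abs_sawtooth_le (x : AddCircle (1 : ℝ)) : |sawtooth x| ≤ 1 := by
  induction x using QuotientAddGroup.induction_on with
  | H x =>
    rw [sawtooth_coe, abs_le]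
    constructor <;> linarith [Int.fract_nonneg x, Int.fract_lt_one x]

theorem integral_sawtooth : ∫ x, sawtooth x = 0 := by
  rw [← AddCircle.intervalIntegral_preimage 1 0]
  have : ∫ x in (0 : ℝ)..0 + 1, sawtooth (x : AddCircle (1 : ℝ)) =
      ∫ x in (0 : ℝ)..1, (x - 1 / 2) := by
    rw [zero_add]
    refine intervalIntegral.integral_congr_Ioo_of_le zero_le_one fun x hx => ?_
    simp only [sawtooth_coe]
    rw [Int.fract_eq_self.2 ⟨hx.1.le, hx.2⟩]
  rw [this]
  simp

/-- The Birkhoff sum over `q` steps of the rotation by `α` of the sawtooth function. -/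
def sawtoothSum (α : ℝ) (q : ℕ) (x : AddCircle (1 : ℝ)) : ℝ :=
  ∑ j ∈ Finset.range q, sawtooth (x + j • (α : AddCircle (1 : ℝ)))

theorem measurable_sawtoothSum (α : ℝ) (q : ℕ) : Measurable (sawtoothSum α q) :=
  Finset.measurable_sum _ fun _ _ => measurable_sawtooth.comp (measurable_add_const _)

theorem IsGoodApprox.abs_sawtoothSum_le {α : ℝ} {q : ℕ} {m : ℤ} (h : IsGoodApprox α q m)
    (x : AddCircle (1 : ℝ)) : |sawtoothSum α q x| ≤ 5 := by
  induction x using QuotientAddGroup.induction_on with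
  | H x =>
    convert h.abs_sum_fract_le x using 2
    refine Finset.sum_congr rfl fun j _ => ?_
    rw [← sawtooth_coe]
    congr 1
    rw [← nsmul_eq_mul]
    rfl

theorem haarAddCircle_one_eq_volume :
    (AddCircle.haarAddCircle : Measure (AddCircle (1 : ℝ))) = volume := by
  rw [AddCircle.volume_eq_smul_haarAddCircle]; simp

theorem norm_zsmul_coe_le (α : ℝ) (q : ℤ) (m : ℤ) :
    ‖q • (α : AddCircle (1 : ℝ))‖ ≤ |q * α - m| := by
  rw [← AddCircle.coe_zsmul, UnitAddCircle.norm_eq, zsmul_eq_mul]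
  exact round_le _ _

theorem fourier_add_nsmul (k : ℤ) (x a : AddCircle (1 : ℝ)) (j : ℕ) :
    fourier k (x + j • a) = fourier k x * fourier k a ^ j := by
  simp only [fourier_apply, smul_add, AddCircle.toCircle_add, smul_comm k j a,
    AddCircle.toCircle_nsmul, Circle.coe_mul, Circle.coe_pow]

theorem fourier_coe_ne_one {α : ℝ} (hα : Irrational α) {k : ℤ} (hk : k ≠ 0) :
    fourier k (α : AddCircle (1 : ℝ)) ≠ 1 := by
  intro h
  have h1 : AddCircle.toCircle (k • (α : AddCircle (1 : ℝ))) =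
      AddCircle.toCircle (0 : AddCircle (1 : ℝ)) := by
    rw [AddCircle.toCircle_zero]
    exact Circle.ext ((fourier_apply (T := (1 : ℝ))).symm.trans h)
  have h2 := AddCircle.injective_toCircle one_ne_zero h1
  rw [← AddCircle.coe_zsmul, AddCircle.coe_eq_zero_iff] at h2
  obtain ⟨n, hn⟩ := h2
  have := (hα.intCast_mul hk).ne_int n
  simp at hn
  exact this hn.symm

theorem integral_fourier_mul_sawtooth (k : ℤ) (y : AddCircle (1 : ℝ)) :
    ∫ s, fourier k s * (sawtooth (y - s) : ℂ) =
      fourier k y * ∫ u, fourier k (-u) * (sawtooth u : ℂ) := by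
  rw [← integral_sub_left_eq_self _ volume y, ← integral_const_mul]
  congr 1
  ext u
  rw [sub_sub_cancel, ← mul_assoc, sub_eq_add_neg]
  congr 1
  simp only [fourier_apply, smul_add, AddCircle.toCircle_add, Circle.coe_mul]

theorem integrable_mul_sawtoothSum {α : ℝ} {q : ℕ} {m : ℤ} (h : IsGoodApprox α q m)
    (x : AddCircle (1 : ℝ)) {f : AddCircle (1 : ℝ) → ℂ} (hf : Integrable f) :
    Integrable fun s => f s * (sawtoothSum α q (x - s) : ℂ) := by
  refine hf.mul_bdd (c := 5) ?_ (ae_of_all _ fun s => ?_)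
  · exact (Complex.measurable_ofReal.comp ((measurable_sawtoothSum α q).comp
      (measurable_const.sub measurable_id))).aestronglyMeasurable
  · rw [Complex.norm_real]
    exact h.abs_sawtoothSum_le _

theorem norm_integral_mul_sawtoothSum_le {α : ℝ} {q : ℕ} {m : ℤ} (h : IsGoodApprox α q m)
    (x : AddCircle (1 : ℝ)) {f : AddCircle (1 : ℝ) → ℂ} (hf : Integrable f) :
    ‖∫ s, f s * (sawtoothSum α q (x - s) : ℂ)‖ ≤ 5 * ∫ s, ‖f s‖ := by
  refine (norm_integral_le_integral_norm _).trans ?_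
  rw [← integral_const_mul]
  refine integral_mono (integrable_mul_sawtoothSum h x hf).norm (hf.norm.const_mul _) fun s => ?_
  simp only [norm_mul, Complex.norm_real]
  rw [mul_comm]
  exact mul_le_mul_of_nonneg_right (h.abs_sawtoothSum_le _) (norm_nonneg _)

/-- `f` has the property that its convolutions with the Birkhoff sums of the sawtooth
function along good approximations of `α` tend uniformly to zero. -/
def SawtoothSumsVanish (α : ℝ) (f : AddCircle (1 : ℝ) → ℂ) : Prop :=
  ∀ η > 0, ∃ δ > 0, ∀ (q : ℕ) (m : ℤ), IsGoodApprox α q m → |q * α - m| < δ →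
    ∀ x, ‖∫ s, f s * (sawtoothSum α q (x - s) : ℂ)‖ ≤ η

theorem sawtoothSumsVanish_fourier {α : ℝ} (hα : Irrational α) (k : ℤ) :
    SawtoothSumsVanish α (fourier k) := by
  intro η hη
  set I : ℂ := ∫ u, fourier k (-u) * (sawtooth u : ℂ) with hI
  have hform : ∀ (q : ℕ) (x : AddCircle (1 : ℝ)),
      ∫ s, fourier k s * (sawtoothSum α q (x - s) : ℂ) =
        fourier k x * I * ∑ j ∈ Finset.range q, fourier k (α : AddCircle (1 : ℝ)) ^ j := by
    intro q x
    simp only [sawtoothSum, Complex.ofReal_sum, Finset.mul_sum]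
    rw [integral_finsetSum]
    · refine Finset.sum_congr rfl fun j _ => ?_
      rw [mul_right_comm, ← fourier_add_nsmul, ← integral_fourier_mul_sawtooth]
      congr 1
      ext s
      rw [add_sub_right_comm]
    · intro j _
      refine Integrable.mul_bdd (c := 1)
        (((fourier k).continuous).integrable_of_hasCompactSupport
          (HasCompactSupport.of_compactSpace _)) ?_ (ae_of_all _ fun s => ?_)
      · exact (Complex.measurable_ofReal.comp (measurable_sawtooth.comp
          ((measurable_const.sub measurable_id).add_const _))).aestronglyMeasurable
      · rw [Complex.norm_real]
        exact abs_sawtooth_le _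
  rcases eq_or_ne k 0 with rfl | hk
  · have hI0 : I = 0 := by
      simp only [hI, fourier_zero, one_mul]
      rw [integral_complex_ofReal, integral_sawtooth, Complex.ofReal_zero]
    refine ⟨1, one_pos, fun q m _ _ x => ?_⟩
    rw [hform, hI0]
    simpa using hη.le
  · set z := fourier k (α : AddCircle (1 : ℝ)) with hz
    have hz1 : 0 < ‖z - 1‖ := norm_pos_iff.2 (sub_ne_zero.2 (fourier_coe_ne_one hα hk))
    have hc : ContinuousAt (fourier k : C(AddCircle (1 : ℝ), ℂ)) 0 :=
      (fourier k).continuous.continuousAt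
    obtain ⟨δ, hδ, hδ'⟩ := Metric.continuousAt_iff.1 hc (η * ‖z - 1‖ / (‖I‖ + 1)) (by positivity)
    refine ⟨δ, hδ, fun q m _ hqm x => ?_⟩
    have h1 : ‖z ^ q - 1‖ < η * ‖z - 1‖ / (‖I‖ + 1) := by
      have := @hδ' ((q : ℤ) • (α : AddCircle (1 : ℝ))) (by
        rw [dist_zero_right]
        exact (norm_zsmul_coe_le α q m).trans_lt (by exact_mod_cast hqm))
      rwa [natCast_zsmul, ← zero_add (q • (α : AddCircle (1 : ℝ))), fourier_add_nsmul,
        fourier_eval_zero, one_mul, dist_eq_norm] at this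
    rw [hform, norm_mul, norm_mul]
    have h2 : ‖∑ j ∈ Finset.range q, z ^ j‖ * ‖z - 1‖ = ‖z ^ q - 1‖ := by
      rw [← norm_mul, geom_sum_mul]
    have h3 : ‖fourier k x‖ = 1 := by rw [fourier_apply]; exact Circle.norm_coe _
    rw [h3, one_mul]
    rw [lt_div_iff₀ (by positivity), ← h2] at h1
    have h4 : ‖∑ j ∈ Finset.range q, z ^ j‖ * (‖I‖ + 1) < η := by
      refine lt_of_mul_lt_mul_right ?_ hz1.le
      linarith
    nlinarith [norm_nonneg (∑ j ∈ Finset.range q, z ^ j)]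

theorem SawtoothSumsVanish.add {α : ℝ} {f g : AddCircle (1 : ℝ) → ℂ} (hfi : Integrable f)
    (hgi : Integrable g) (hf : SawtoothSumsVanish α f) (hg : SawtoothSumsVanish α g) :
    SawtoothSumsVanish α (f + g) := by
  intro η hη
  obtain ⟨δ₁, hδ₁, h₁⟩ := hf (η / 2) (by positivity)
  obtain ⟨δ₂, hδ₂, h₂⟩ := hg (η / 2) (by positivity)
  refine ⟨min δ₁ δ₂, lt_min hδ₁ hδ₂, fun q m hqm hlt x => ?_⟩
  simp only [Pi.add_apply, add_mul]
  rw [integral_add (integrable_mul_sawtoothSum hqm x hfi) (integrable_mul_sawtoothSum hqm x hgi)]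
  refine (norm_add_le _ _).trans ?_
  linarith [h₁ q m hqm (hlt.trans_le (min_le_left _ _)) x,
    h₂ q m hqm (hlt.trans_le (min_le_right _ _)) x]

theorem SawtoothSumsVanish.const_smul {α : ℝ} {f : AddCircle (1 : ℝ) → ℂ} (c : ℂ)
    (hf : SawtoothSumsVanish α f) : SawtoothSumsVanish α (c • f) := by
  intro η hη
  obtain ⟨δ, hδ, h⟩ := hf (η / (‖c‖ + 1)) (by positivity)
  refine ⟨δ, hδ, fun q m hqm hlt x => ?_⟩
  simp only [Pi.smul_apply, smul_eq_mul, mul_assoc]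
  rw [integral_const_mul, norm_mul]
  have := h q m hqm hlt x
  rw [le_div_iff₀ (by positivity)] at this
  nlinarith [norm_nonneg (∫ s, f s * (sawtoothSum α q (x - s) : ℂ))]

theorem SawtoothSumsVanish.congr_ae {α : ℝ} {f g : AddCircle (1 : ℝ) → ℂ} (hfg : f =ᵐ[volume] g)
    (hf : SawtoothSumsVanish α f) : SawtoothSumsVanish α g := by
  intro η hη
  obtain ⟨δ, hδ, h⟩ := hf η hη
  refine ⟨δ, hδ, fun q m hqm hlt x => ?_⟩
  rw [← integral_congr_ae (hfg.mono fun s hs => by simp only [hs] :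
    (fun s => f s * (sawtoothSum α q (x - s) : ℂ)) =ᵐ[volume] _)]
  exact h q m hqm hlt x

theorem sawtoothSumsVanish_of_integrable {α : ℝ} (hα : Irrational α)
    {f : AddCircle (1 : ℝ) → ℂ} (hf : Integrable f) : SawtoothSumsVanish α f := by
  have hvol := haarAddCircle_one_eq_volume
  have hspan : ∀ g ∈ Submodule.span ℂ (Set.range (fourierLp (T := (1 : ℝ)) 1)),
      SawtoothSumsVanish α g := by
    intro g hg
    induction hg using Submodule.span_induction with
    | mem g hg =>
      obtain ⟨k, rfl⟩ := hg
      refine (sawtoothSumsVanish_fourier hα k).congr_ae ?_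
      rw [← hvol]
      exact (coeFn_fourierLp 1 k).symm
    | zero =>
      refine ((sawtoothSumsVanish_fourier hα 0).const_smul 0).congr_ae ?_
      rw [← hvol, zero_smul]
      exact (Lp.coeFn_zero ..).symm
    | add g g' _ _ hg hg' =>
      refine (hg.add ?_ ?_ hg').congr_ae ?_
      · rw [← hvol]; exact L1.integrable_coeFn g
      · rw [← hvol]; exact L1.integrable_coeFn g'
      · rw [← hvol]; exact (Lp.coeFn_add ..).symm
    | smul c g _ hg =>
      refine (hg.const_smul c).congr_ae ?_
      rw [← hvol]; exact (Lp.coeFn_smul ..).symm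
  have hf' : Integrable f AddCircle.haarAddCircle := by rwa [hvol]
  intro η hη
  have hmem : hf'.toL1 f ∈ closure
      (Submodule.span ℂ (Set.range (fourierLp (T := (1 : ℝ)) 1)) : Set _) := by
    rw [← Submodule.topologicalClosure_coe, span_fourierLp_closure_eq_top ENNReal.one_ne_top]
    trivial
  obtain ⟨g, hg, hfg⟩ := Metric.mem_closure_iff.1 hmem (η / 10) (by positivity)
  obtain ⟨δ, hδ, h⟩ := hspan g hg (η / 2) (by positivity)
  have hgi : Integrable g := by rw [← hvol]; exact L1.integrable_coeFn g
  have hdist : ∫ s, ‖f s - g s‖ < η / 10 := by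
    rw [dist_eq_norm, L1.norm_eq_integral_norm] at hfg
    rw [← hvol]
    refine lt_of_eq_of_lt (integral_congr_ae ?_) hfg
    filter_upwards [Lp.coeFn_sub (hf'.toL1 f) g, hf'.coeFn_toL1] with s h1 h2
    rw [h1, Pi.sub_apply, h2]
  refine ⟨δ, hδ, fun q m hqm hlt x => ?_⟩
  have h1 := norm_integral_mul_sawtoothSum_le hqm x (hf.sub hgi)
  have h2 := h q m hqm hlt x
  have e : ∫ s, f s * (sawtoothSum α q (x - s) : ℂ) =
      (∫ s, (f - g) s * (sawtoothSum α q (x - s) : ℂ)) +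
        ∫ s, g s * (sawtoothSum α q (x - s) : ℂ) := by
    rw [← integral_add (integrable_mul_sawtoothSum hqm x (hf.sub hgi))
      (integrable_mul_sawtoothSum hqm x hgi)]
    congr 1
    ext s
    simp only [Pi.sub_apply]
    ring
  rw [e]
  refine (norm_add_le _ _).trans ?_
  simp only [Pi.sub_apply] at h1 ⊢
  linarith

/-- An absolutely continuous function is, up to a constant, the convolution of an integrable
function with the sawtooth function. -/
theorem AbsolutelyContinuous'.exists_sawtooth_repr {φ : AddCircle (1 : ℝ) → ℝ}
    (hφ : AbsolutelyContinuous' φ) :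
    ∃ (c : ℝ) (G : AddCircle (1 : ℝ) → ℂ), Integrable G ∧
      ∀ y, (φ y : ℂ) = c - ∫ s, G s * (sawtooth (y - s) : ℂ) := by
  obtain ⟨g, hg, hφg⟩ := hφ
  have hgi : IntervalIntegrable g volume 0 1 := by
    rw [intervalIntegrable_iff_integrableOn_Icc_of_le zero_le_one]; exact hg
  have hsg : IntervalIntegrable (fun s => g s * s) volume 0 1 :=
    hgi.mul_continuousOn continuousOn_id
  have hg0 : ∫ s in (0 : ℝ)..1, g s = 0 := by
    rw [← hφg 1 (by simp), sub_eq_zero]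
    congr 1
    exact AddCircle.coe_period (1 : ℝ)
  refine ⟨φ ((0 : ℝ) : AddCircle (1 : ℝ)) - ∫ s in (0 : ℝ)..1, g s * s,
    AddCircle.liftIoc 1 0 fun s => (g s : ℂ), ?_, ?_⟩
  · rw [← memLp_one_iff_integrable]
    refine MemLp.memLp_liftIoc ?_
    rw [memLp_one_iff_integrable, zero_add]
    exact (hg.mono_set Set.Ioc_subset_Icc_self).ofReal
  · intro y'
    obtain ⟨y, hy, rfl⟩ : y' ∈ Set.image ((↑) : ℝ → AddCircle (1 : ℝ)) (Set.Ico 0 (0 + 1)) := by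
      rw [AddCircle.coe_image_Ico_eq]; trivial
    rw [zero_add] at hy
    have hy' : y ∈ Set.Icc (0 : ℝ) 1 := ⟨hy.1, hy.2.le⟩
    have hyu : y ∈ Set.uIcc (0 : ℝ) 1 := by rwa [Set.uIcc_of_le zero_le_one]
    have h1 : IntervalIntegrable g volume 0 y := hgi.mono_set (Set.uIcc_subset_uIcc_left hyu)
    have h2 : IntervalIntegrable g volume y 1 := hgi.mono_set (Set.uIcc_subset_uIcc_right hyu)
    have hL1 : ∫ s in (0 : ℝ)..y, g s * sawtooth ((y : AddCircle (1 : ℝ)) - (s : ℝ)) =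
        ∫ s in (0 : ℝ)..y, g s * (y - s - 1 / 2) := by
      refine intervalIntegral.integral_congr_Ioo_of_le hy.1 fun s hs => ?_
      rw [← AddCircle.coe_sub, sawtooth_coe,
        Int.fract_eq_self.2 ⟨by linarith [hs.2], by linarith [hs.1, hy.2]⟩]
    have hL2 : ∫ s in y..1, g s * sawtooth ((y : AddCircle (1 : ℝ)) - (s : ℝ)) =
        ∫ s in y..1, g s * (y - s + 1 / 2) := by
      refine intervalIntegral.integral_congr_Ioo_of_le hy.2.le fun s hs => ?_
      rw [← AddCircle.coe_sub, sawtooth_coe, ← Int.fract_add_one,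
        Int.fract_eq_self.2 ⟨by linarith [hs.2, hy.1], by linarith [hs.1]⟩]
      ring
    have hcirc : ∫ s : AddCircle (1 : ℝ), AddCircle.liftIoc 1 0 (fun s => (g s : ℂ)) s *
        (sawtooth ((y : AddCircle (1 : ℝ)) - s) : ℂ) =
        ((∫ s in (0 : ℝ)..1, g s * sawtooth ((y : AddCircle (1 : ℝ)) - (s : ℝ)) : ℝ) : ℂ) := by
      rw [← AddCircle.intervalIntegral_preimage 1 0, zero_add, ← intervalIntegral.integral_ofReal]
      refine intervalIntegral.integral_congr_Ioo_of_le zero_le_one fun s hs => ?_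
      rw [AddCircle.liftIoc_coe_apply ⟨hs.1, by linarith [hs.2]⟩]
      push_cast
      rfl
    have hm : ∀ z : AddCircle (1 : ℝ), Measurable fun s : ℝ => sawtooth (z - (s : ℝ)) := fun z =>
      measurable_sawtooth.comp (measurable_const.sub AddCircle.measurable_mk')
    have hint : IntervalIntegrable (fun s => g s * sawtooth ((y : AddCircle (1 : ℝ)) - (s : ℝ)))
        volume 0 1 := by
      rw [intervalIntegrable_iff] at hgi ⊢
      exact Integrable.mul_bdd (c := 1) hgi (hm _).aestronglyMeasurable
        (ae_of_all _ fun s => abs_sawtooth_le _)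
    have hφy := hφg y hy'
    have e1 : ∫ s in (0 : ℝ)..y, g s * (y - s - 1 / 2) =
        (y - 1 / 2) * (∫ s in (0 : ℝ)..y, g s) - ∫ s in (0 : ℝ)..y, g s * s := by
      rw [← intervalIntegral.integral_const_mul, ← intervalIntegral.integral_sub (h1.const_mul _)
        (hsg.mono_set (Set.uIcc_subset_uIcc_left hyu))]
      congr 1; ext s; ring
    have e2 : ∫ s in y..1, g s * (y - s + 1 / 2) =
        (y + 1 / 2) * (∫ s in y..1, g s) - ∫ s in y..1, g s * s := by
      rw [← intervalIntegral.integral_const_mul, ← intervalIntegral.integral_sub (h2.const_mul _)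
        (hsg.mono_set (Set.uIcc_subset_uIcc_right hyu))]
      congr 1; ext s; ring
    have e3 := intervalIntegral.integral_add_adjacent_intervals h1 h2
    have e4 := intervalIntegral.integral_add_adjacent_intervals
      (hsg.mono_set (Set.uIcc_subset_uIcc_left hyu)) (hsg.mono_set (Set.uIcc_subset_uIcc_right hyu))
    have e5 := intervalIntegral.integral_add_adjacent_intervals
      (hint.mono_set (Set.uIcc_subset_uIcc_left hyu))
      (hint.mono_set (Set.uIcc_subset_uIcc_right hyu))
    rw [hcirc, ← e5, hL1, hL2, e1, e2, ← e4]
    have e6 : ∫ s in y..1, g s = -∫ s in (0 : ℝ)..y, g s := by linarith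
    rw [e6, ← hφy]
    push_cast
    ring

/-- The improved Denjoy–Koksma theorem: the Birkhoff sums of a zero mean absolutely continuous
function along good approximations of `α` tend uniformly to zero. -/
theorem birkhoffSum_vanish_of_absolutelyContinuous {α : ℝ} (hα : Irrational α)
    {φ : AddCircle (1 : ℝ) → ℝ} (hφcont : Continuous φ) (hφint : ∫ x, φ x = 0)
    (hφac : AbsolutelyContinuous' φ) {η : ℝ} (hη : 0 < η) :
    ∃ δ > 0, ∀ (q : ℕ) (m : ℤ), IsGoodApprox α q m → |q * α - m| < δ →
      ∀ x, |∑ j ∈ Finset.range q, φ (x + j • (α : AddCircle (1 : ℝ)))| ≤ η := by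
  obtain ⟨c, G, hG, hrepr⟩ := hφac.exists_sawtooth_repr
  have hv := sawtoothSumsVanish_of_integrable hα hG
  have hsum : ∀ (q : ℕ) x,
      ((∑ j ∈ Finset.range q, φ (x + j • (α : AddCircle (1 : ℝ))) - q * c : ℝ) : ℂ)
      = -∫ s, G s * (sawtoothSum α q (x - s) : ℂ) := by
    intro q x
    push_cast
    simp only [hrepr, Finset.sum_sub_distrib, sawtoothSum, Complex.ofReal_sum, Finset.mul_sum]
    rw [integral_finsetSum]
    · simp only [Finset.sum_const, Finset.card_range, nsmul_eq_mul, add_sub_right_comm]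
      ring
    · intro j _
      refine hG.mul_bdd (c := 1) ?_ (ae_of_all _ fun s => ?_)
      · exact (Complex.measurable_ofReal.comp (measurable_sawtooth.comp
          ((measurable_const.sub measurable_id).add_const _))).aestronglyMeasurable
      · rw [Complex.norm_real]
        exact abs_sawtooth_le _
  have hbound : ∀ η > 0, ∃ δ > 0, ∀ (q : ℕ) (m : ℤ), IsGoodApprox α q m → |q * α - m| < δ →
      ∀ x, |∑ j ∈ Finset.range q, φ (x + j • (α : AddCircle (1 : ℝ))) - q * c| ≤ η := by
    intro η hη
    obtain ⟨δ, hδ, h⟩ := hv η hη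
    refine ⟨δ, hδ, fun q m hqm hlt x => ?_⟩
    have := h q m hqm hlt x
    rwa [← norm_neg, ← hsum, Complex.norm_real] at this
  have hφi : ∀ a : AddCircle (1 : ℝ), Integrable fun x => φ (x + a) := fun a =>
    (hφcont.comp (continuous_add_const a)).integrable_of_hasCompactSupport
      (HasCompactSupport.of_compactSpace _)
  have hc : c = 0 := by
    by_contra hc
    have hc' : 0 < |c| := abs_pos.2 hc
    obtain ⟨δ, hδ, h⟩ := hbound 1 one_pos
    obtain ⟨N, hN⟩ := exists_nat_gt (1 / |c|)
    obtain ⟨p, q, m, l, -, hq, -, hNq, hpδ, hqp, -⟩ := exists_consecutive_goodApprox hα hδ N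
    have h1 := h q l hq (hqp.trans hpδ)
    have h2 : ∫ x, (∑ j ∈ Finset.range q, φ (x + j • (α : AddCircle (1 : ℝ))) - q * c) =
        -(q * c) := by
      rw [integral_sub (integrable_finsetSum _ fun j _ => hφi _) (integrable_const _),
        integral_finsetSum _ fun j _ => hφi _]
      simp only [integral_add_right_eq_self, hφint]
      simp [Measure.real]
    have h3 := norm_integral_le_of_norm_le_const (μ := volume) (C := 1)
      (f := fun x => ∑ j ∈ Finset.range q, φ (x + j • (α : AddCircle (1 : ℝ))) - q * c)
      (ae_of_all _ h1)
    rw [h2] at h3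
    simp [Measure.real] at h3
    rw [div_lt_iff₀ hc'] at hN
    have : (N : ℝ) < q := by exact_mod_cast hNq
    nlinarith
  simpa [hc] using hbound η hη

theorem anzai_pow_apply_s19 (α : ℝ) (φ : AddCircle (1 : ℝ) → ℝ) (q : ℕ) (z : AddCircle (1 : ℝ) × ℝ) :
    ((anzai α φ) ^ q) z = (z.1 + q • (α : AddCircle (1 : ℝ)),
      z.2 + ∑ j ∈ Finset.range q, φ (z.1 + j • (α : AddCircle (1 : ℝ)))) := by
  induction q with
  | zero => simp
  | succ q ih =>
    rw [pow_succ', Equiv.Perm.mul_apply, ih, Finset.sum_range_succ, succ_nsmul, ← add_assoc,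
      ← add_assoc]
    rfl

theorem anzai_zpow_apply_fst (α : ℝ) (φ : AddCircle (1 : ℝ) → ℝ) (n : ℤ)
    (z : AddCircle (1 : ℝ) × ℝ) :
    (((anzai α φ) ^ n) z).1 = z.1 + n • (α : AddCircle (1 : ℝ)) := by
  obtain ⟨q, rfl | rfl⟩ := n.eq_nat_or_neg
  · rw [zpow_natCast, anzai_pow_apply_s19, natCast_zsmul]
  · have h := anzai_pow_apply_s19 α φ q (((anzai α φ) ^ (-(q : ℤ))) z)
    rw [← zpow_natCast, ← Equiv.Perm.mul_apply, ← zpow_add, add_neg_cancel, zpow_zero,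
      Equiv.Perm.one_apply] at h
    have h1 := congrArg Prod.fst h
    rw [neg_smul, natCast_zsmul, ← sub_eq_add_neg]
    exact eq_sub_of_add_eq h1.symm

/-- A uniform bound on the Birkhoff sums over `q` steps bounds the vertical displacement between
points of an orbit whose times differ by `q`. -/
theorem abs_anzai_zpow_snd_sub_le {α : ℝ} {φ : AddCircle (1 : ℝ) → ℝ} {q : ℕ} {η : ℝ}
    (h : ∀ x, |∑ j ∈ Finset.range q, φ (x + j • (α : AddCircle (1 : ℝ)))| ≤ η)
    (z : AddCircle (1 : ℝ) × ℝ) {n n' : ℤ} (hn : |n - n'| = q) :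
    |(((anzai α φ) ^ n') z).2 - (((anzai α φ) ^ n) z).2| ≤ η := by
  have key : ∀ k : ℤ, |(((anzai α φ) ^ (q + k)) z).2 - (((anzai α φ) ^ k) z).2| ≤ η := by
    intro k
    rw [zpow_add, Equiv.Perm.mul_apply, zpow_natCast, anzai_pow_apply_s19, add_sub_cancel_left]
    exact h _
  rcases eq_or_eq_neg_of_abs_eq hn with h' | h'
  · rw [abs_sub_comm, show n = q + n' by omega]
    exact key n'
  · rw [show n' = q + n by omega]
    exact key n

theorem dist_anzai_zpow_fst (α : ℝ) (φ : AddCircle (1 : ℝ) → ℝ) (n : ℤ)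
    (z : AddCircle (1 : ℝ) × ℝ) :
    dist (((anzai α φ) ^ n) z).1 z.1 = ‖n • (α : AddCircle (1 : ℝ))‖ := by
  rw [anzai_zpow_apply_fst, dist_eq_norm, add_sub_cancel_left]

/-- An orbit whose returns near its starting point have bounded height is bounded. -/
theorem anzai_orbit_bounded_of_returns_bounded {α : ℝ} (hα : Irrational α)
    {φ : AddCircle (1 : ℝ) → ℝ} (hφcont : Continuous φ) (z : AddCircle (1 : ℝ) × ℝ) {a δ : ℝ}
    (hδ : 0 < δ) (h : ∀ n : ℤ, dist (((anzai α φ) ^ n) z).1 z.1 ≤ δ →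
      |(((anzai α φ) ^ n) z).2 - z.2| ≤ a) :
    ∃ M : ℝ, ∀ n : ℤ, |(((anzai α φ) ^ n) z).2| ≤ M := by
  obtain ⟨C, hC⟩ : ∃ C, ∀ x, |φ x| ≤ C := by
    obtain ⟨C, hC⟩ := (isCompact_range hφcont).isBounded.exists_norm_le
    exact ⟨C, fun x => hC _ ⟨x, rfl⟩⟩
  have hdense : DenseRange fun k : ℤ => k • (α : AddCircle (1 : ℝ)) :=
    AddCircle.denseRange_zsmul_coe_iff.2 (by rwa [div_one])
  obtain ⟨t, ht⟩ := isCompact_univ.elim_finite_subcover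
    (fun k : ℤ => {x : AddCircle (1 : ℝ) | dist (x + k • (α : AddCircle (1 : ℝ))) z.1 < δ})
    (fun k => isOpen_lt (by fun_prop) continuous_const) (fun x _ => by
      obtain ⟨k, hk⟩ := hdense.exists_dist_lt (z.1 - x) hδ
      refine Set.mem_iUnion.2 ⟨k, ?_⟩
      rw [dist_comm, dist_eq_norm] at hk
      rw [Set.mem_ofPred_eq, dist_eq_norm]
      convert hk using 2
      abel)
  refine ⟨|z.2| + a + ∑ k ∈ t, k.natAbs * C, fun n => ?_⟩
  obtain ⟨k, hkt, hk⟩ : ∃ k ∈ t, dist ((((anzai α φ) ^ n) z).1 + k • (α : AddCircle (1 : ℝ))) z.1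
      < δ := by simpa using ht (Set.mem_univ (((anzai α φ) ^ n) z).1)
  have hC0 : 0 ≤ C := (abs_nonneg _).trans (hC 0)
  have h1 := h (n + k) (by
    rw [anzai_zpow_apply_fst, add_smul, ← add_assoc, ← anzai_zpow_apply_fst α φ]
    exact hk.le)
  have hB : ∀ x, |∑ j ∈ Finset.range k.natAbs, φ (x + j • (α : AddCircle (1 : ℝ)))| ≤
      k.natAbs * C := fun x => by
    refine (Finset.abs_sum_le_sum_abs _ _).trans ((Finset.sum_le_sum fun j _ => hC _).trans ?_)
    simp
  have h2 := abs_anzai_zpow_snd_sub_le hB z (n := n + k) (n' := n) (by simp)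
  have h3 : (k.natAbs * C : ℝ) ≤ ∑ k ∈ t, k.natAbs * C :=
    Finset.single_le_sum (f := fun k : ℤ => (k.natAbs * C : ℝ)) (fun i _ => by positivity) hkt
  have h4 := abs_le.1 h1
  have h5 := abs_le.1 h2
  have h6 := abs_le.1 (le_refl |z.2|)
  rw [abs_le]
  constructor <;> linarith

/-- If the orbit of `(x₀,y₀)` avoids the double rectangle
`{ ‖x−x₀‖ ≤ ε, a ≤ |y−y₀| ≤ b }`, then it avoids `{ ‖x−x₀‖ ≤ δ, |y−y₀| ≥ a }` for some
`δ > 0`; in particular the orbit is bounded. -/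
theorem stmt_19 (α : ℝ) (hα : Irrational α) (φ : AddCircle (1 : ℝ) → ℝ)
    (hφcont : Continuous φ) (hφint : ∫ x : AddCircle (1 : ℝ), φ x = 0)
    (hφac : AbsolutelyContinuous' φ)
    (x₀ : AddCircle (1 : ℝ)) (y₀ : ℝ) (a b ε : ℝ) (ha : 0 < a) (hab : a < b) (hε : 0 < ε)
    (havoid : ∀ n : ℤ,
      ¬ (dist (((anzai α φ) ^ n) (x₀, y₀)).1 x₀ ≤ ε ∧
         a ≤ |(((anzai α φ) ^ n) (x₀, y₀)).2 - y₀| ∧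
         |(((anzai α φ) ^ n) (x₀, y₀)).2 - y₀| ≤ b)) :
    (∃ δ > 0, ∀ n : ℤ,
      ¬ (dist (((anzai α φ) ^ n) (x₀, y₀)).1 x₀ ≤ δ ∧
         a ≤ |(((anzai α φ) ^ n) (x₀, y₀)).2 - y₀|)) ∧
    ∃ M : ℝ, ∀ n : ℤ, |(((anzai α φ) ^ n) (x₀, y₀)).2| ≤ M := by
  obtain ⟨δ₀, hδ₀, hsmall⟩ := birkhoffSum_vanish_of_absolutelyContinuous hα hφcont hφint hφac
    (η := (b - a) / 2) (by linarith)
  obtain ⟨p, q, m, l, hp, hq, hpq, -, hpδ, hqp, hneg, hbest⟩ :=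
    exists_consecutive_goodApprox hα (lt_min hδ₀ hε) 0
  have hpδ₀ := hpδ.trans_le (min_le_left _ _)
  have hret : ∀ n : ℤ, dist (((anzai α φ) ^ n) (x₀, y₀)).1 x₀ ≤ |q * α - l| →
      |(((anzai α φ) ^ n) (x₀, y₀)).2 - y₀| < a := by
    intro n hn
    rw [dist_anzai_zpow_fst α φ n (x₀, y₀), ← AddCircle.coe_zsmul, UnitAddCircle.norm_eq,
      zsmul_eq_mul] at hn
    refine induction_on_returns_abs
      (P := fun n => |(((anzai α φ) ^ n) (x₀, y₀)).2 - y₀| < a) hp.pos hpq hqp hneg hbest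
      (by simpa using ha) ?_ n _ hn
    rintro n n' hnn ⟨k, hk⟩ hn
    have hjump : |(((anzai α φ) ^ n') (x₀, y₀)).2 - (((anzai α φ) ^ n) (x₀, y₀)).2| ≤
        (b - a) / 2 := by
      rcases hnn with hnn | hnn
      · exact abs_anzai_zpow_snd_sub_le (hsmall p m hp hpδ₀) _ hnn
      · exact abs_anzai_zpow_snd_sub_le (hsmall q l hq (hqp.trans hpδ₀)) _ hnn
    have hnear : dist (((anzai α φ) ^ n') (x₀, y₀)).1 x₀ ≤ ε := by
      rw [dist_anzai_zpow_fst α φ n' (x₀, y₀)]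
      exact (norm_zsmul_coe_le α n' k).trans (hk.trans (hpδ.le.trans (min_le_right _ _)))
    by_contra! hge
    refine havoid n' ⟨hnear, hge, ?_⟩
    have := abs_sub_le (((anzai α φ) ^ n') (x₀, y₀)).2 (((anzai α φ) ^ n) (x₀, y₀)).2 y₀
    linarith
  have hδ : 0 < |q * α - l| := abs_pos.2 (right_ne_zero_of_mul hneg.ne)
  exact ⟨⟨_, hδ, fun n ⟨h1, h2⟩ => (hret n h1).not_ge h2⟩,
    anzai_orbit_bounded_of_returns_bounded hα hφcont (x₀, y₀) hδ fun n hn => (hret n hn).le⟩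
end
end
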